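/- Let Z(λ), Ẑ(λ) be C¹ families of 2n×2n symplectic matrices on [a,b] such that Ẑ(λ)⁻¹ Z(λ) is constant in λ, Ψ(Ẑ(λ)) and Ψ(Z(λ)) satisfy Ẑᵀ(Ψ(Z)−Ψ(Ẑ))Ẑ ≥ 0, and the lower-right n×n block of Ψ(Ẑ(λ)) is ≥ 0. Set Y(λ) = Z(λ)(0;I), Ŷ(λ) = Ẑ(λ)(0;I). Then the numbers of proper focal points satisfy l_c(Ŷ,a,b) − l_c(Y,a,b) = μ(Y(a),Ŷ(a)) − μ(Y(b),Ŷ(b)). -/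

import Mathlib

open Matrix
noncomputable section

/-- The standard symplectic matrix `J = [[0, I], [-I, 0]]`. -/
def Jmat (k : Type*) [Fintype k] [DecidableEq k] : Matrix (k ⊕ k) (k ⊕ k) ℝ :=
  fromBlocks 0 1 (-1) 0

/-- A matrix `S` is symplectic if `Sᵀ J S = J`. -/
def IsSymplectic {k : Type*} [Fintype k] [DecidableEq k]
    (S : Matrix (k ⊕ k) (k ⊕ k) ℝ) : Prop :=
  Sᵀ * Jmat k * S = Jmat k

/-- `S'` is the (entrywise) derivative family of the matrix family `S`. -/
def HasMatDeriv {k m : Type*} (S S' : ℝ → Matrix k m ℝ) : Prop :=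
  ∀ (l : ℝ) (i : k) (j : m), HasDerivAt (fun t => S t i j) (S' l i j) l

/-- `Ψ(S(λ)) = Jᵀ S'(λ) S(λ)⁻¹`, where `S'` is a derivative family of `S`. -/
def Psi {k : Type*} [Fintype k] [DecidableEq k]
    (S S' : ℝ → Matrix (k ⊕ k) (k ⊕ k) ℝ) (l : ℝ) : Matrix (k ⊕ k) (k ⊕ k) ℝ :=
  (Jmat k)ᵀ * S' l * (S l)⁻¹

open Classical in
/-- The Moore–Penrose pseudoinverse, defined via the four Penrose conditions. -/
def pinv {m k : Type*} [Fintype m] [Fintype k] (A : Matrix m k ℝ) : Matrix k m ℝ :=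
  if h : ∃ B : Matrix k m ℝ,
      A * B * A = A ∧ B * A * B = B ∧ (A * B)ᵀ = A * B ∧ (B * A)ᵀ = B * A
  then h.choose else 0

/-- `ind A`: the number of negative eigenvalues (with multiplicity) of a symmetric matrix. -/
def negInd {k : Type*} [Fintype k] [DecidableEq k] (A : Matrix k k ℝ) : ℕ :=
  if h : A.IsHermitian then Fintype.card {i // h.eigenvalues i < 0} else 0

/-- The Wronskian `w(Y, Ŷ) = Yᵀ J Ŷ`. -/
def wron {k m : Type*} [Fintype k] [Fintype m] [DecidableEq k]
    (Y Yh : Matrix (k ⊕ k) m ℝ) : Matrix m m ℝ :=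
  Yᵀ * Jmat k * Yh

/-- The matrix `M = (I − X X†) X̂` from the definition of the comparative index. -/
def compM {k m : Type*} [Fintype k] [Fintype m] [DecidableEq k]
    (Y Yh : Matrix (k ⊕ k) m ℝ) : Matrix k m ℝ :=
  let X := Y.submatrix Sum.inl id
  let Xh := Yh.submatrix Sum.inl id
  Xh - X * pinv X * Xh

/-- The matrix `D = T w(Y,Ŷ)ᵀ X† X̂ T` (with `T = I − M† M`) from the comparative index. -/
def compD {k m : Type*} [Fintype k] [Fintype m] [DecidableEq k] [DecidableEq m]
    (Y Yh : Matrix (k ⊕ k) m ℝ) : Matrix m m ℝ :=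
  let X := Y.submatrix Sum.inl id
  let Xh := Yh.submatrix Sum.inl id
  let T : Matrix m m ℝ := 1 - pinv (compM Y Yh) * compM Y Yh
  T * (wron Y Yh)ᵀ * pinv X * Xh * T

/-- The comparative index `μ(Y, Ŷ) = rank M + ind D`. -/
def compIdx {k m : Type*} [Fintype k] [Fintype m] [DecidableEq k] [DecidableEq m]
    (Y Yh : Matrix (k ⊕ k) m ℝ) : ℕ :=
  (compM Y Yh).rank + negInd (compD Y Yh)

/-- The dual comparative index `μ*(Y, Ŷ) = rank M + ind (−D)`. -/
def dualCompIdx {k m : Type*} [Fintype k] [Fintype m] [DecidableEq k] [DecidableEq m]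
    (Y Yh : Matrix (k ⊕ k) m ℝ) : ℕ :=
  (compM Y Yh).rank + negInd (-(compD Y Yh))

/-- A `2n×n` matrix `Y = (X; U)` is a conjoined basis: `rank Y = n` and `Xᵀ U` symmetric. -/
def IsConjoinedBasis {k m : Type*} [Fintype k] [Fintype m] [DecidableEq k]
    (Y : Matrix (k ⊕ k) m ℝ) : Prop :=
  Y.rank = Fintype.card m ∧ ((Y.submatrix Sum.inl id)ᵀ * Y.submatrix Sum.inr id).IsSymm

open Classical in
/-- The left-hand limit value of an `ℕ`-valued function at `x`
(defaulting to `f x` if the left limit does not exist). -/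
def leftVal (f : ℝ → ℕ) (x : ℝ) : ℕ :=
  if h : ∃ r, ∀ᶠ t in nhdsWithin x (Set.Iio x), f t = r then h.choose else f x

/-- The jump `f(x⁻) − f(x)` at `x`, as an integer. -/
def jmp (f : ℝ → ℕ) (x : ℝ) : ℤ := (leftVal f x : ℤ) - (f x : ℤ)


section NegIndex
variable {k l : Type*} [Fintype k] [DecidableEq k] [Fintype l] [DecidableEq l]

theorem herm_spectral {A : Matrix k k ℝ} (hA : A.IsHermitian) :
    ∃ U : Matrix k k ℝ, Uᵀ * U = 1 ∧ U * Uᵀ = 1 ∧ A = U * diagonal hA.eigenvalues * Uᵀ := by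
  refine ⟨(hA.eigenvectorUnitary : Matrix k k ℝ), ?_, ?_, ?_⟩
  · have := (Matrix.mem_unitaryGroup_iff').1 hA.eigenvectorUnitary.2
    simpa [star_eq_conjTranspose] using this
  · have := (Matrix.mem_unitaryGroup_iff).1 hA.eigenvectorUnitary.2
    simpa [star_eq_conjTranspose] using this
  · conv_lhs => rw [hA.spectral_theorem]
    simp [Unitary.conjStarAlgAut_apply, star_eq_conjTranspose]

theorem le_negInd {r : Type*} [Fintype r] [DecidableEq r] {A : Matrix k k ℝ} (hA : A.IsHermitian)
    (P : Matrix k r ℝ) (hP : (-(Pᵀ * A * P)).PosDef) : Fintype.card r ≤ negInd A := by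
  obtain ⟨U, hU, -, hAU⟩ := herm_spectral hA
  rw [negInd, dif_pos hA]
  let L : (r → ℝ) →ₗ[ℝ] ({i // hA.eigenvalues i < 0} → ℝ) :=
    (LinearMap.funLeft ℝ ℝ Subtype.val) ∘ₗ (Uᵀ * P).mulVecLin
  have hL : Function.Injective L := by
    rw [← LinearMap.ker_eq_bot, LinearMap.ker_eq_bot']
    intro v hv
    by_contra hne
    have h1 := hP.dotProduct_mulVec_pos hne
    have h2 : (star v) ⬝ᵥ (-(Pᵀ * A * P)) *ᵥ v
        = - ∑ i, hA.eigenvalues i * (((Uᵀ * P) *ᵥ v) i) ^ 2 := by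
      have : Pᵀ * A * P = (Uᵀ * P)ᵀ * (diagonal hA.eigenvalues * (Uᵀ * P)) := by
        conv_lhs => rw [hAU]
        simp only [transpose_mul, transpose_transpose, Matrix.mul_assoc]
      rw [neg_mulVec, dotProduct_neg, this, ← mulVec_mulVec, ← mulVec_mulVec, star_trivial,
        dotProduct_mulVec, vecMul_transpose]
      simp only [dotProduct, mulVec_diagonal]
      congr 1
      exact Finset.sum_congr rfl fun i _ => by ring
    rw [h2] at h1
    have h3 : 0 ≤ ∑ i, hA.eigenvalues i * (((Uᵀ * P) *ᵥ v) i) ^ 2 := by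
      apply Finset.sum_nonneg
      intro i _
      by_cases hi : hA.eigenvalues i < 0
      · have : ((Uᵀ * P) *ᵥ v) i = 0 := congrFun hv ⟨i, hi⟩
        simp [this]
      · exact mul_nonneg (not_lt.1 hi) (sq_nonneg _)
    linarith
  simpa using LinearMap.finrank_le_finrank_of_injective hL

theorem exists_negInd (A : Matrix k k ℝ) :
    ∃ P : Matrix k (Fin (negInd A)) ℝ, (-(Pᵀ * A * P)).PosDef := by
  by_cases hA : A.IsHermitian
  · obtain ⟨U, hU, -, hAU⟩ := herm_spectral hA
    have hc : negInd A = Fintype.card {i // hA.eigenvalues i < 0} := by rw [negInd, dif_pos hA]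
    let e : Fin (negInd A) ≃ {i // hA.eigenvalues i < 0} :=
      (finCongr hc).trans (Fintype.equivFin _).symm
    let σ : Fin (negInd A) → k := fun i => (e i).1
    have hσ : Function.Injective σ := Subtype.val_injective.comp e.injective
    refine ⟨U.submatrix id σ, ?_⟩
    have : (U.submatrix id σ)ᵀ * A * U.submatrix id σ
        = diagonal (fun i => hA.eigenvalues (σ i)) := by
      have h1 : Uᵀ * A * U = diagonal hA.eigenvalues := by
        conv_lhs => rw [hAU]
        calc Uᵀ * (U * diagonal hA.eigenvalues * Uᵀ) * U
            = (Uᵀ * U) * diagonal hA.eigenvalues * (Uᵀ * U) := by simp only [Matrix.mul_assoc]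
          _ = _ := by rw [hU]; simp
      have h2 : (U.submatrix id σ)ᵀ * A * U.submatrix id σ = (Uᵀ * A * U).submatrix σ σ := by
        ext i j
        simp [Matrix.mul_apply]
      rw [h2, h1, submatrix_diagonal _ _ hσ]
      rfl
    rw [this, diagonal_neg, posDef_diagonal_iff]
    intro i
    have := (e i).2
    simpa [σ] using this
  · have hc : negInd A = 0 := by rw [negInd, dif_neg hA]
    have : IsEmpty (Fin (negInd A)) := by rw [hc]; infer_instance
    refine ⟨0, ?_⟩
    refine Matrix.PosDef.of_dotProduct_mulVec_pos ?_ ?_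
    · ext i; exact this.elim i
    · intro x hx; exact absurd (Subsingleton.elim _ _) hx

theorem isHerm_iff {k : Type*} {A : Matrix k k ℝ} : A.IsHermitian ↔ Aᵀ = A := by
  rw [IsHermitian, conjTranspose_eq_transpose_of_trivial]

theorem negInd_congr_le {A : Matrix k k ℝ} (hA : A.IsHermitian) (Q : Matrix k l ℝ) :
    negInd (Qᵀ * A * Q) ≤ negInd A := by
  obtain ⟨P, hP⟩ := exists_negInd (Qᵀ * A * Q)
  have := le_negInd hA (Q * P) (by
    convert hP using 2
    simp only [transpose_mul, Matrix.mul_assoc])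
  simpa using this

theorem herm_congr {k l : Type*} [Fintype k] {A : Matrix k k ℝ} (hA : A.IsHermitian) (Q : Matrix k l ℝ) :
    (Qᵀ * A * Q).IsHermitian := by
  rw [isHerm_iff] at *
  simp only [transpose_mul, transpose_transpose, hA, Matrix.mul_assoc]

theorem negInd_congr {A : Matrix k k ℝ} (hA : A.IsHermitian) (Q : Matrix k k ℝ)
    (hQ : IsUnit Q.det) : negInd (Qᵀ * A * Q) = negInd A := by
  refine le_antisymm (negInd_congr_le hA Q) ?_
  have := negInd_congr_le (herm_congr hA Q) Q⁻¹
  have h2 : (Q⁻¹)ᵀ * (Qᵀ * A * Q) * Q⁻¹ = A := by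
    calc (Q⁻¹)ᵀ * (Qᵀ * A * Q) * Q⁻¹ = (Q * Q⁻¹)ᵀ * A * (Q * Q⁻¹) := by
          simp only [transpose_mul, Matrix.mul_assoc]
      _ = A := by rw [mul_nonsing_inv _ hQ]; simp
  rwa [h2] at this

theorem negInd_anti {A B : Matrix k k ℝ} (hA : A.IsHermitian) (hAB : (B - A).PosSemidef) :
    negInd B ≤ negInd A := by
  obtain ⟨P, hP⟩ := exists_negInd B
  have h2 : (Pᵀ * (B - A) * P).PosSemidef := by
    simpa using hAB.conjTranspose_mul_mul_same P
  have := le_negInd hA P (by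
    have := hP.add_posSemidef h2
    convert this using 1
    rw [Matrix.mul_sub, Matrix.sub_mul]; abel)
  simpa using this

theorem negInd_eq_roots {A : Matrix k k ℝ} (hA : A.IsHermitian) :
    negInd A = (A.charpoly.roots.filter (fun x => x < 0)).card := by
  rw [negInd, dif_pos hA, hA.roots_charpoly_eq_eigenvalues, Multiset.filter_map, Multiset.card_map,
    Fintype.card_subtype]
  rfl

theorem rank_eq_negInd {A : Matrix k k ℝ} (hA : A.IsHermitian) :
    A.rank = negInd A + negInd (-A) := by
  have hnA : (-A).IsHermitian := hA.neg
  have key : negInd (-A) = Fintype.card {i // 0 < hA.eigenvalues i} := by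
    obtain ⟨U, hU, hU', hAU⟩ := herm_spectral hA
    have h3 : (-A).charpoly = ∏ i, (Polynomial.X - Polynomial.C (-hA.eigenvalues i)) := by
      have : -A = U * (diagonal (fun i => -hA.eigenvalues i) * Uᵀ) := by
        conv_lhs => rw [hAU]
        rw [← Matrix.mul_assoc]
        have : diagonal (fun i => -hA.eigenvalues i) = -diagonal hA.eigenvalues := by
          rw [diagonal_neg]
        rw [this, Matrix.mul_neg, Matrix.neg_mul]
      rw [this, charpoly_mul_comm, Matrix.mul_assoc, hU, Matrix.mul_one, charpoly_diagonal]
    rw [negInd_eq_roots hnA, h3, Polynomial.roots_prod, Multiset.bind]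
    · simp only [Polynomial.roots_X_sub_C]
      rw [← Multiset.bind, Multiset.bind_singleton, Multiset.filter_map, Multiset.card_map,
        Fintype.card_subtype]
      simp
      rfl
    · exact Finset.prod_ne_zero_iff.2 fun i _ => Polynomial.X_sub_C_ne_zero _
  rw [hA.rank_eq_card_non_zero_eigs, key, negInd, dif_pos hA]
  simp only [Fintype.card_subtype]
  rw [← Finset.card_union_of_disjoint]
  · congr 1; ext i; simp [lt_or_lt_iff_ne]
  · rw [Finset.disjoint_filter]; intro i _ h1 h2; linarith

theorem negInd_add {A B : Matrix k k ℝ} (hA : A.IsHermitian) (hB : B.IsHermitian)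
    (hAB : A * B = 0) : negInd (A + B) = negInd A + negInd B := by
  have h : A.charpoly * B.charpoly = Polynomial.X ^ (Fintype.card k) * (A + B).charpoly := by
    simp only [Matrix.charpoly]
    rw [← det_mul, ← det_smul]
    congr 1
    have : (A.map Polynomial.C) * (B.map Polynomial.C) = 0 := by
      rw [← Matrix.map_mul, hAB]; simp
    simp only [charmatrix, RingHom.mapMatrix_apply]
    rw [Matrix.map_add _ (by simp)]
    have hs : (scalar k) (Polynomial.X : Polynomial ℝ) = (Polynomial.X : Polynomial ℝ) • 1 := by
      rw [scalar_apply, smul_one_eq_diagonal]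
    rw [hs, sub_mul, mul_sub, mul_sub, this]
    simp only [Matrix.smul_mul, Matrix.mul_smul, Matrix.one_mul, Matrix.mul_one, smul_sub, smul_add]
    abel
  have hne : A.charpoly * B.charpoly ≠ 0 :=
    mul_ne_zero (charpoly_monic A).ne_zero (charpoly_monic B).ne_zero
  have h2 := congrArg (fun p => (p.roots.filter (fun x => x < 0)).card) h
  rw [Polynomial.roots_mul hne, Polynomial.roots_mul (h ▸ hne), Polynomial.roots_pow,
    Polynomial.roots_X] at h2
  rw [negInd_eq_roots hA, negInd_eq_roots hB, negInd_eq_roots (hA.add hB)]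
  simp only [Multiset.filter_add, Multiset.card_add] at h2
  rw [Multiset.filter_nsmul] at h2
  have h0 : Multiset.filter (fun x : ℝ => x < 0) {0} = 0 := by
    rw [Multiset.filter_singleton]; simp
  rw [h0] at h2
  simp at h2
  omega


theorem negInd_lsc (A : Matrix k k ℝ) :
    ∀ᶠ B in nhds A, B.IsHermitian → negInd A ≤ negInd B := by
  obtain ⟨P, hP⟩ := exists_negInd A
  have hcont : Continuous (fun q : Matrix k k ℝ × (Fin (negInd A) → ℝ) =>
      q.2 ⬝ᵥ ((-(Pᵀ * q.1 * P)) *ᵥ q.2)) := by fun_prop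
  have h1 : ∀ᶠ B in nhds A, ∀ v ∈ Metric.sphere (0 : Fin (negInd A) → ℝ) 1,
      0 < v ⬝ᵥ ((-(Pᵀ * B * P)) *ᵥ v) := by
    apply (isCompact_sphere (0 : Fin (negInd A) → ℝ) 1).eventually_forall_of_forall_eventually
    intro v hv
    have hv0 : v ≠ 0 := by
      rintro rfl; simp at hv
    have := hP.dotProduct_mulVec_pos hv0
    rw [star_trivial] at this
    exact (hcont.tendsto (A, v)).eventually (lt_mem_nhds this)
  filter_upwards [h1] with B hB hBh
  have := le_negInd hBh P (by
    refine Matrix.PosDef.of_dotProduct_mulVec_pos (herm_congr hBh P).neg ?_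
    intro v hv
    have hn : ‖v‖ ≠ 0 := norm_ne_zero_iff.2 hv
    have h2 := hB (‖v‖⁻¹ • v) (by simp [norm_smul, hn])
    rw [mulVec_smul, smul_dotProduct, dotProduct_smul, smul_eq_mul, smul_eq_mul, ← mul_assoc] at h2
    rw [star_trivial]
    exact (mul_pos_iff_of_pos_left (by positivity)).1 h2)
  simpa using this

theorem negInd_zero : negInd (0 : Matrix k k ℝ) = 0 := by
  have := rank_eq_negInd (A := (0 : Matrix k k ℝ)) isHermitian_zero
  rw [rank_zero] at this
  omega

theorem negInd_blockDiag {A : Matrix k k ℝ} {D : Matrix l l ℝ} (hA : A.IsHermitian)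
    (hD : D.IsHermitian) : negInd (fromBlocks A 0 0 D) = negInd A + negInd D := by
  have h : (fromBlocks A 0 0 D).IsHermitian := by
    rw [isHerm_iff] at *; simp [fromBlocks_transpose, hA, hD]
  rw [negInd_eq_roots hA, negInd_eq_roots hD, negInd_eq_roots h, charpoly_fromBlocks_zero₁₂,
    Polynomial.roots_mul (mul_ne_zero (charpoly_monic A).ne_zero (charpoly_monic D).ne_zero),
    Multiset.filter_add, Multiset.card_add]

theorem negInd_offDiag (M : Matrix k l ℝ) : negInd (fromBlocks 0 M Mᵀ 0) = M.rank := by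
  have h : (fromBlocks 0 M Mᵀ 0).IsHermitian := by
    rw [isHerm_iff]; simp [fromBlocks_transpose]
  have h1 : negInd (-(fromBlocks 0 M Mᵀ 0)) = negInd (fromBlocks 0 M Mᵀ 0) := by
    rw [← negInd_congr h (fromBlocks 1 0 0 (-1))]
    · congr 1
      simp [fromBlocks_transpose, fromBlocks_multiply, fromBlocks_neg]
    · simp [det_neg]
  have h2 := rank_eq_negInd h
  rw [h1, ← rank_transpose_mul_self] at h2
  simp only [fromBlocks_transpose, fromBlocks_multiply, transpose_transpose, transpose_zero] at h2
  simp only [Matrix.zero_mul, Matrix.mul_zero, zero_add, add_zero] at h2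
  have hL : (M * Mᵀ).IsHermitian := by rw [isHerm_iff]; simp
  have hR : (Mᵀ * M).IsHermitian := by rw [isHerm_iff]; simp
  have hB : (fromBlocks (M * Mᵀ) 0 0 (Mᵀ * M)).IsHermitian := by
    rw [isHerm_iff]; simp [fromBlocks_transpose]
  rw [rank_eq_negInd hB, fromBlocks_neg, neg_zero, neg_zero, negInd_blockDiag hL hR,
    negInd_blockDiag hL.neg hR.neg] at h2
  have h3 := rank_eq_negInd hL
  have h4 := rank_eq_negInd hR
  rw [rank_self_mul_transpose] at h3
  rw [rank_transpose_mul_self] at h4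
  omega

theorem exists_pinv {k l : Type*} [Fintype k] [Fintype l] [DecidableEq l] (A : Matrix k l ℝ) : ∃ B : Matrix l k ℝ,
    A * B * A = A ∧ B * A * B = B ∧ (A * B)ᵀ = A * B ∧ (B * A)ᵀ = B * A := by
  have hH : (Aᵀ * A).IsHermitian := by rw [isHerm_iff]; simp
  obtain ⟨U, hU, hU', hAU⟩ := herm_spectral hH
  set e := hH.eigenvalues
  obtain ⟨G, hG⟩ : ∃ G, G = U * diagonal (fun i => (e i)⁻¹) * Uᵀ := ⟨_, rfl⟩
  have hGt : Gᵀ = G := by rw [hG]; simp [Matrix.mul_assoc]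
  have hmul : ∀ d d' : l → ℝ, (U * diagonal d * Uᵀ) * (U * diagonal d' * Uᵀ)
      = U * diagonal (fun i => d i * d' i) * Uᵀ := by
    intro d d'
    calc (U * diagonal d * Uᵀ) * (U * diagonal d' * Uᵀ)
        = U * diagonal d * (Uᵀ * U) * diagonal d' * Uᵀ := by simp only [Matrix.mul_assoc]
      _ = _ := by rw [hU, Matrix.mul_one, Matrix.mul_assoc U, diagonal_mul_diagonal]
  have hGH : G * (Aᵀ * A) = U * diagonal (fun i => (e i)⁻¹ * e i) * Uᵀ := by
    rw [hG, hAU, hmul]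
  have hHGH : (Aᵀ * A) * (G * (Aᵀ * A)) = Aᵀ * A := by
    rw [hGH]
    conv_lhs => rw [hAU]
    rw [hmul]
    conv_rhs => rw [hAU]
    congr 3
    funext i
    by_cases h : e i = 0
    · simp [h]
    · field_simp
  have hGHG : G * (Aᵀ * A) * G = G := by
    rw [hGH]
    conv_lhs => rw [hG]
    rw [hmul]
    conv_rhs => rw [hG]
    congr 3
    funext i
    by_cases h : e i = 0
    · simp [h]
    · field_simp
  have hGHt : (G * (Aᵀ * A))ᵀ = G * (Aᵀ * A) := by rw [hGH]; simp [Matrix.mul_assoc]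
  refine ⟨G * Aᵀ, ?_, ?_, ?_, ?_⟩
  · have h0 : Aᴴ * A * (G * (Aᵀ * A) - 1) = 0 := by
      rw [conjTranspose_eq_transpose_of_trivial, Matrix.mul_sub, hHGH]; simp
    rw [conjTranspose_mul_self_mul_eq_zero] at h0
    rw [Matrix.mul_sub, sub_eq_zero, Matrix.mul_one] at h0
    simpa only [Matrix.mul_assoc] using h0
  · calc G * Aᵀ * A * (G * Aᵀ) = G * (Aᵀ * A) * G * Aᵀ := by simp only [Matrix.mul_assoc]
      _ = _ := by rw [hGHG]
  · simp [hGt, Matrix.mul_assoc]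
  · rw [Matrix.mul_assoc]; exact hGHt

theorem pinv_spec {k l : Type*} [Fintype k] [Fintype l] [DecidableEq l] (A : Matrix k l ℝ) :
    A * pinv A * A = A ∧ pinv A * A * pinv A = pinv A ∧ (A * pinv A)ᵀ = A * pinv A ∧
      (pinv A * A)ᵀ = pinv A * A := by
  rw [pinv, dif_pos (exists_pinv A)]
  exact (exists_pinv A).choose_spec

theorem negInd_tri {S D : Matrix k k ℝ} {M : Matrix k k ℝ} (hS : S.IsHermitian)
    (hD : D.IsHermitian) (hSM : S * M = 0) (hMD : M * D = 0) :
    negInd (fromBlocks S M Mᵀ D) = negInd S + M.rank + negInd D := by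
  have h1 : (fromBlocks S 0 0 D).IsHermitian := by
    rw [isHerm_iff] at *; simp [fromBlocks_transpose, hS, hD]
  have h2 : (fromBlocks 0 M Mᵀ 0).IsHermitian := by
    rw [isHerm_iff]; simp [fromBlocks_transpose]
  have hDM : D * Mᵀ = 0 := by
    rw [isHerm_iff] at hD
    have := congrArg transpose hMD
    rwa [transpose_mul, hD, transpose_zero] at this
  have h3 := negInd_add h1 h2 (by simp [fromBlocks_multiply, hSM, hDM])
  rw [fromBlocks_add, negInd_blockDiag hS hD, negInd_offDiag] at h3
  simp only [add_zero, zero_add] at h3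
  omega

theorem alg_main (X V Xh Vh : Matrix k k ℝ) (hXV : Xᵀ * V = Vᵀ * X)
    (hXVh : Xhᵀ * Vh = Vhᵀ * Xh) (hV : IsUnit V.det) (hVh : IsUnit Vh.det)
    (M T D : Matrix k k ℝ) (hM : M = Xh - X * pinv X * Xh) (hT : T = 1 - pinv M * M)
    (hD : D = T * (Xᵀ * Vh - Vᵀ * Xh)ᵀ * pinv X * Xh * T) :
    (X * V⁻¹).IsHermitian ∧ (Xh * Vh⁻¹).IsHermitian ∧
    negInd (X * V⁻¹) + (M.rank + negInd D)
      = negInd (Xh * Vh⁻¹) + negInd (X * V⁻¹ - Xh * Vh⁻¹) := by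
  have symm_aux : ∀ X V : Matrix k k ℝ, Xᵀ * V = Vᵀ * X → IsUnit V.det →
      (X * V⁻¹)ᵀ = X * V⁻¹ := by
    intro X V h hV
    have h1 : (V * V⁻¹)ᵀ = 1 := by rw [mul_nonsing_inv _ hV, transpose_one]
    calc (X * V⁻¹)ᵀ = (V⁻¹)ᵀ * Xᵀ * (V * V⁻¹) := by
          rw [mul_nonsing_inv _ hV, transpose_mul, Matrix.mul_one]
      _ = (V⁻¹)ᵀ * (Xᵀ * V) * V⁻¹ := by simp only [Matrix.mul_assoc]
      _ = (V * V⁻¹)ᵀ * X * V⁻¹ := by rw [h, transpose_mul]; simp only [Matrix.mul_assoc]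
      _ = _ := by rw [h1, Matrix.one_mul]
  obtain ⟨S, hS⟩ : ∃ S, S = X * V⁻¹ := ⟨_, rfl⟩
  obtain ⟨Sh, hSh⟩ : ∃ S, S = Xh * Vh⁻¹ := ⟨_, rfl⟩
  have hSt : Sᵀ = S := by rw [hS]; exact symm_aux X V hXV hV
  have hSht : Shᵀ = Sh := by rw [hSh]; exact symm_aux Xh Vh hXVh hVh
  have hSV : S * V = X := by rw [hS, Matrix.mul_assoc, nonsing_inv_mul _ hV, Matrix.mul_one]
  have hShV : Sh * Vh = Xh := by rw [hSh, Matrix.mul_assoc, nonsing_inv_mul _ hVh, Matrix.mul_one]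
  have hVS : Vᵀ * S = Xᵀ := by rw [← hSV, transpose_mul, hSt]
  have hVhS : Vhᵀ * Sh = Xhᵀ := by rw [← hShV, transpose_mul, hSht]
  rw [← hS, ← hSh]
  refine ⟨isHerm_iff.2 hSt, isHerm_iff.2 hSht, ?_⟩
  obtain ⟨p1, p2, p3, p4⟩ := pinv_spec X
  obtain ⟨q1, q2, q3, q4⟩ := pinv_spec M
  obtain ⟨N, hN⟩ : ∃ N, N = pinv M := ⟨_, rfl⟩
  obtain ⟨g, hg⟩ : ∃ g, g = pinv X * Xh := ⟨_, rfl⟩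
  rw [← hN] at q1 q2 q3 q4 hT
  have hM' : M = Xh - X * g := by rw [hM, hg, Matrix.mul_assoc]
  have hXtM : Xᵀ * M = 0 := by
    have : Xᵀ * (X * pinv X) = Xᵀ := by
      conv_lhs => rw [← p3]
      rw [← transpose_mul, p1]
    rw [hM, Matrix.mul_sub, ← Matrix.mul_assoc, this, sub_self]
  have hSM : S * M = 0 := by
    have : S = (V⁻¹)ᵀ * Xᵀ := by rw [← transpose_mul, ← hS, hSt]
    rw [this, Matrix.mul_assoc, hXtM, Matrix.mul_zero]
  have hMT : M * T = 0 := by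
    rw [hT, Matrix.mul_sub, Matrix.mul_one, ← Matrix.mul_assoc, q1, sub_self]
  have hTt : Tᵀ = T := by rw [hT, transpose_sub, q4, transpose_one]
  have hSN : S * Nᵀ = 0 := by
    have : Nᵀ = M * N * Nᵀ := by
      conv_lhs => rw [← q2]
      rw [Matrix.mul_assoc, transpose_mul, q3]
    rw [this, ← Matrix.mul_assoc, ← Matrix.mul_assoc, hSM]; simp
  obtain ⟨C, hC⟩ : ∃ C, C = gᵀ * (Vᵀ * X) * g - gᵀ * Vᵀ * Xh - Xhᵀ * V * g + Vhᵀ * Xh := ⟨_, rfl⟩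
  have hCt : Cᵀ = C := by
    rw [hC]
    simp only [transpose_add, transpose_sub, transpose_mul, transpose_transpose, hXV, hXVh,
      Matrix.mul_assoc]
    abel
  obtain ⟨K, hK⟩ : ∃ K, K = -(Nᵀ * C * (1 - (1/2 : ℝ) • (N * M))) := ⟨_, rfl⟩
  have hSK : S * K = 0 := by
    rw [hK, Matrix.mul_neg, ← Matrix.mul_assoc, ← Matrix.mul_assoc, hSN]; simp
  have hKS : Kᵀ * S = 0 := by
    have := congrArg transpose hSK
    rwa [transpose_mul, hSt, transpose_zero] at this
  have hXhT : Xh * T = X * g * T := by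
    have : Xh = M + X * g := by rw [hM']; abel
    conv_lhs => rw [this]
    rw [Matrix.add_mul, hMT, zero_add]
  have hTXh : T * Xhᵀ = T * (gᵀ * Xᵀ) := by
    have := congrArg transpose hXhT
    simpa only [transpose_mul, hTt] using this
  have hTCT : T * C * T = D := by
    have e1 : T * (gᵀ * (Vᵀ * X) * g) * T = T * (gᵀ * Vᵀ * Xh) * T := by
      simp only [Matrix.mul_assoc]; rw [hXhT]; simp only [Matrix.mul_assoc]
    have e2 : D = T * (Vhᵀ * Xh) * T - T * (Xhᵀ * V * g) * T := by
      rw [hD, transpose_sub, transpose_mul, transpose_mul, transpose_transpose, transpose_transpose]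
      rw [Matrix.mul_assoc _ (pinv X) Xh, ← hg]
      simp only [Matrix.mul_assoc, Matrix.sub_mul, Matrix.mul_sub]
      rw [hXhT]; simp only [Matrix.mul_assoc]
    rw [e2, hC]
    simp only [Matrix.mul_add, Matrix.add_mul, Matrix.mul_sub, Matrix.sub_mul] at e1 ⊢
    rw [e1]; abel
  have hDh : D.IsHermitian := by
    rw [isHerm_iff, ← hTCT]
    simp only [transpose_mul, hTt, hCt, Matrix.mul_assoc]
  have hMD : M * D = 0 := by rw [← hTCT, ← Matrix.mul_assoc, ← Matrix.mul_assoc, hMT]; simp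
  have hMK : Mᵀ * K = -(N * M * C * (1 - (1/2 : ℝ) • (N * M))) := by
    rw [hK, Matrix.mul_neg, ← Matrix.mul_assoc, ← Matrix.mul_assoc, ← transpose_mul, q4]
  have hKM : Kᵀ * M = -((1 - (1/2 : ℝ) • (N * M)) * C * (N * M)) := by
    have := congrArg transpose hMK
    simp only [transpose_mul, transpose_transpose, transpose_neg, transpose_sub, transpose_one,
      transpose_smul, hCt] at this
    rw [← transpose_mul, q4] at this
    rw [this, Matrix.mul_assoc]
  have hCK : C + Kᵀ * M + Mᵀ * K = D := by
    rw [hMK, hKM, ← hTCT, hT]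
    simp only [Matrix.mul_sub, Matrix.sub_mul, Matrix.mul_one, Matrix.one_mul, Matrix.smul_mul,
      Matrix.mul_smul]
    module
  have hherm0 : (fromBlocks Sh 0 0 (S - Sh)).IsHermitian := by
    rw [isHerm_iff]; simp [fromBlocks_transpose, hSt, hSht]
  have hN0 : (fromBlocks 1 1 1 0 : Matrix (k ⊕ k) (k ⊕ k) ℝ)ᵀ * fromBlocks Sh 0 0 (S - Sh) *
      fromBlocks 1 1 1 0 = fromBlocks S Sh Sh Sh := by
    simp [fromBlocks_transpose, fromBlocks_multiply]
  have hherm1 : (fromBlocks S Sh Sh Sh).IsHermitian := by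
    rw [isHerm_iff]; simp [fromBlocks_transpose, hSt, hSht]
  have hdet : IsUnit (fromBlocks 1 1 1 0 : Matrix (k ⊕ k) (k ⊕ k) ℝ).det := by
    rw [det_fromBlocks_one₁₁]; simp [det_neg]
  have i1 := negInd_congr hherm0 _ hdet
  rw [hN0, negInd_blockDiag (isHerm_iff.2 hSht) (isHerm_iff.2 (by simp [hSt, hSht]))] at i1
  obtain ⟨K', hK'⟩ : ∃ K', K' = K - V * g := ⟨_, rfl⟩
  have hSK' : S * K' + Sh * Vh = M := by
    rw [hK', Matrix.mul_sub, hSK, hShV, ← Matrix.mul_assoc, hSV, hM']; abel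
  have hdet2 : IsUnit (fromBlocks 1 K' 0 Vh : Matrix (k ⊕ k) (k ⊕ k) ℝ).det := by
    rw [det_fromBlocks_zero₂₁]; simpa using hVh
  have hN1 : (fromBlocks 1 K' 0 Vh : Matrix (k ⊕ k) (k ⊕ k) ℝ)ᵀ * fromBlocks S Sh Sh Sh *
      fromBlocks 1 K' 0 Vh = fromBlocks S M Mᵀ D := by
    rw [fromBlocks_transpose, fromBlocks_multiply, fromBlocks_multiply]
    simp only [transpose_one, transpose_zero, Matrix.one_mul, Matrix.zero_mul, Matrix.mul_one,
      Matrix.mul_zero, add_zero]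
    congr 1
    · rw [← hSK']; simp [hSt, hSht]
    · have : Xh = M + X * g := by rw [hM']; abel
      have hKX : Kᵀ * X = 0 := by rw [← hSV, ← Matrix.mul_assoc, hKS, Matrix.zero_mul]
      have hXK : Xᵀ * K = 0 := by rw [← hVS, Matrix.mul_assoc, hSK, Matrix.mul_zero]
      have hKXh : Kᵀ * Xh = Kᵀ * M := by
        rw [this, Matrix.mul_add, ← Matrix.mul_assoc, hKX]; simp
      have hXhK : Xhᵀ * K = Mᵀ * K := by
        rw [this, transpose_add, transpose_mul, Matrix.add_mul, Matrix.mul_assoc, hXK]; simp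
      rw [← hCK, ← hKXh, ← hXhK, hC, Matrix.add_mul, Matrix.add_mul, Matrix.mul_assoc _ Sh Vh,
        hShV, hVhS, Matrix.mul_assoc _ S K', hXVh, hK', Matrix.mul_sub,
        hSK, ← Matrix.mul_assoc S, hSV, transpose_sub, transpose_mul]
      simp only [Matrix.mul_sub, Matrix.sub_mul, zero_sub, Matrix.mul_neg]
      rw [← Matrix.mul_assoc Kᵀ X g, hKX]
      simp only [Matrix.mul_assoc, Matrix.zero_mul]
      abel
  have i2 := negInd_congr hherm1 _ hdet2
  rw [hN1, negInd_tri (isHerm_iff.2 hSt) hDh hSM hMD] at i2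
  omega

end NegIndex

section Jumps
open Filter Topology Set

theorem leftVal_eq {f : ℝ → ℕ} {x : ℝ} {r : ℕ} (h : ∀ᶠ t in 𝓝[<] x, f t = r) :
    leftVal f x = r := by
  have hex : ∃ r, ∀ᶠ t in 𝓝[<] x, f t = r := ⟨r, h⟩
  rw [leftVal, dif_pos hex]
  obtain ⟨t, h1, h2⟩ := (hex.choose_spec.and h).exists
  rw [← h1, h2]

theorem jmp_const {f : ℝ → ℕ} {p q : ℝ} {r : ℕ} (h : ∀ t ∈ Ioo p q, f t = r) :
    ∀ y ∈ Ioo p q, jmp f y = 0 := by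
  intro y hy
  rw [jmp, leftVal_eq (r := r), h y hy, sub_self]
  filter_upwards [Ioo_mem_nhdsLT hy.1] with t ht
  exact h t ⟨ht.1, ht.2.trans hy.2⟩

/-- The jump relation on an interval. -/
def JRel (f fh : ℝ → ℕ) (c : ℝ → ℤ) (s t : ℝ) : Prop :=
  (Ioc s t ∩ Function.support (jmp f)).Finite ∧ (Ioc s t ∩ Function.support (jmp fh)).Finite ∧
    (∑ᶠ x ∈ Ioc s t, jmp fh x) - (∑ᶠ x ∈ Ioc s t, jmp f x) = c s - c t

theorem JRel.trans {f fh : ℝ → ℕ} {c : ℝ → ℤ} {s t u : ℝ} (hst : s ≤ t) (htu : t ≤ u)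
    (h1 : JRel f fh c s t) (h2 : JRel f fh c t u) : JRel f fh c s u := by
  obtain ⟨a1, a2, a3⟩ := h1
  obtain ⟨b1, b2, b3⟩ := h2
  have hU : Ioc s u = Ioc s t ∪ Ioc t u := (Ioc_union_Ioc_eq_Ioc hst htu).symm
  have hd : Disjoint (Ioc s t) (Ioc t u) := by
    rw [Set.disjoint_left]; intro x hx hx'; exact absurd hx.2 (not_le.2 hx'.1)
  refine ⟨?_, ?_, ?_⟩
  · rw [hU, union_inter_distrib_right]; exact a1.union b1
  · rw [hU, union_inter_distrib_right]; exact a2.union b2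
  · rw [hU, finsum_mem_union' hd a1 b1, finsum_mem_union' hd a2 b2]
    linarith

theorem sum_zero {g : ℝ → ℤ} {s : Set ℝ} (h : ∀ x ∈ s, g x = 0) :
    (s ∩ Function.support g).Finite ∧ ∑ᶠ x ∈ s, g x = 0 := by
  constructor
  · convert Set.finite_empty
    ext x; simp only [mem_inter_iff, Function.mem_support, mem_empty_iff_false, iff_false]
    rintro ⟨h1, h2⟩; exact h2 (h x h1)
  · exact finsum_mem_eq_zero_of_forall_eq_zero h

theorem sum_single {g : ℝ → ℤ} {p x : ℝ} (hp : p < x) (h : ∀ y ∈ Ioo p x, g y = 0) :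
    (Ioc p x ∩ Function.support g).Finite ∧ ∑ᶠ y ∈ Ioc p x, g y = g x := by
  constructor
  · apply (Set.finite_singleton x).subset
    rintro y ⟨h1, h2⟩
    by_contra hne
    exact h2 (h y ⟨h1.1, lt_of_le_of_ne h1.2 hne⟩)
  · rw [finsum_eq_single _ x]
    · simp [hp]
    · intro y hy
      by_cases hm : y ∈ Ioc p x
      · have := h y ⟨hm.1, lt_of_le_of_ne hm.2 hy⟩
        simp [this]
      · simp only [hm, finsum_false]

theorem jump_main {a b : ℝ} (hab : a ≤ b) (f fh : ℝ → ℕ) (c : ℝ → ℤ)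
    (hL : ∀ x ∈ Ioc a b, ∃ (r rh : ℕ) (cL : ℤ),
      (∀ᶠ t in 𝓝[<] x, f t = r ∧ fh t = rh ∧ c t = cL) ∧
        ((rh : ℤ) - fh x) - ((r : ℤ) - f x) = cL - c x)
    (hR : ∀ x ∈ Ico a b, ∃ (r rh : ℕ), ∀ᶠ t in 𝓝[>] x, f t = r ∧ fh t = rh ∧ c t = c x) :
    (∑ᶠ x ∈ Ioc a b, jmp fh x) - (∑ᶠ x ∈ Ioc a b, jmp f x) = c a - c b := by
  have left : ∀ x ∈ Icc a b, ∃ l < x, ∀ p ∈ Icc a b, l < p → p < x →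
      JRel f fh c p x ∧ ∀ q, p ≤ q → q < x → JRel f fh c p q := by
    intro x hx
    rcases eq_or_lt_of_le hx.1 with h | h
    · refine ⟨x - 1, by linarith, fun p hp _ hpx => ?_⟩
      exact absurd hp.1 (by rw [h]; exact not_le.2 hpx)
    · obtain ⟨r, rh, cL, hev, heq⟩ := hL x ⟨h, hx.2⟩
      obtain ⟨l, hl, hsub⟩ := (mem_nhdsLT_iff_exists_Ioo_subset).1 hev
      have hf : ∀ t ∈ Ioo l x, f t = r := fun t ht => (hsub ht).1
      have hfh : ∀ t ∈ Ioo l x, fh t = rh := fun t ht => (hsub ht).2.1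
      have hc : ∀ t ∈ Ioo l x, c t = cL := fun t ht => (hsub ht).2.2
      have jf := jmp_const hf
      have jfh := jmp_const hfh
      refine ⟨l, hl, fun p hp hlp hpx => ⟨?_, fun q hpq hqx => ?_⟩⟩
      · have s1 := sum_single hpx (fun y hy => jf y ⟨hlp.trans hy.1, hy.2⟩)
        have s2 := sum_single hpx (fun y hy => jfh y ⟨hlp.trans hy.1, hy.2⟩)
        refine ⟨s1.1, s2.1, ?_⟩
        have hlx : ∀ᶠ t in 𝓝[<] x, t ∈ Ioo l x := Ioo_mem_nhdsLT hl
        rw [s1.2, s2.2, hc p ⟨hlp, hpx⟩, jmp, jmp, leftVal_eq (hlx.mono hf),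
          leftVal_eq (hlx.mono hfh)]
        exact heq
      · have s1 := sum_zero (s := Ioc p q)
          (fun y hy => jf y ⟨hlp.trans hy.1, hy.2.trans_lt hqx⟩)
        have s2 := sum_zero (s := Ioc p q)
          (fun y hy => jfh y ⟨hlp.trans hy.1, hy.2.trans_lt hqx⟩)
        refine ⟨s1.1, s2.1, ?_⟩
        rw [s1.2, s2.2, hc p ⟨hlp, hpx⟩, hc q ⟨hlp.trans_le hpq, hqx⟩]; simp
  have right : ∀ x ∈ Icc a b, ∃ u > x, ∀ q ∈ Icc a b, q < u →
      ∀ p, x ≤ p → p ≤ q → JRel f fh c p q := by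
    intro x hx
    rcases eq_or_lt_of_le hx.2 with h | h
    · refine ⟨x + 1, by linarith, fun q hq _ p hp hpq => ?_⟩
      have : p = q := le_antisymm hpq (hq.2.trans (h ▸ hp))
      subst this
      simp [JRel]
    · obtain ⟨r, rh, hev⟩ := hR x ⟨hx.1, h⟩
      obtain ⟨u, hu, hsub⟩ := (mem_nhdsGT_iff_exists_Ioo_subset).1 hev
      have hf : ∀ t ∈ Ioo x u, f t = r := fun t ht => (hsub ht).1
      have hfh : ∀ t ∈ Ioo x u, fh t = rh := fun t ht => (hsub ht).2.1
      have hc : ∀ t ∈ Ico x u, c t = c x := by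
        intro t ht
        rcases eq_or_lt_of_le ht.1 with h | h
        · rw [h]
        · exact (hsub ⟨h, ht.2⟩).2.2
      have jf := jmp_const hf
      have jfh := jmp_const hfh
      refine ⟨u, hu, fun q hq hqu p hxp hpq => ?_⟩
      have s1 := sum_zero (s := Ioc p q)
        (fun y hy => jf y ⟨hxp.trans_lt hy.1, hy.2.trans_lt hqu⟩)
      have s2 := sum_zero (s := Ioc p q)
        (fun y hy => jfh y ⟨hxp.trans_lt hy.1, hy.2.trans_lt hqu⟩)
      refine ⟨s1.1, s2.1, ?_⟩
      rw [s1.2, s2.2, hc p ⟨hxp, hpq.trans_lt hqu⟩, hc q ⟨hxp.trans hpq, hqu⟩]; simp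
  choose! l hl hl' using left
  choose! u hu hu' using right
  obtain ⟨t, ht0, hmono, ⟨m, hm⟩, hcov⟩ := exists_monotone_Icc_subset_open_cover_Icc hab
    (c := fun x : Icc a b => {y : Icc a b | l x < y ∧ (y : ℝ) < u x})
    (fun x => (isOpen_lt continuous_const continuous_subtype_val).inter
      (isOpen_lt continuous_subtype_val continuous_const))
    (fun x _ => mem_iUnion.2 ⟨x, hl x x.2, hu x x.2⟩)
  have step : ∀ n, JRel f fh c (t n) (t (n + 1)) := by
    intro n
    obtain ⟨x, hx⟩ := hcov n
    have hle : t n ≤ t (n + 1) := hmono n.le_succ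
    have h1 := hx (left_mem_Icc.2 hle)
    have h2 := hx (right_mem_Icc.2 hle)
    by_cases hxn : (x : ℝ) ≤ t n
    · exact hu' x x.2 _ (t (n + 1)).2 h2.2 _ hxn hle
    · have hxn := not_le.1 hxn
      have h3 := hl' x x.2 _ (t n).2 h1.1 hxn
      by_cases hxn' : (x : ℝ) ≤ t (n + 1)
      · exact h3.1.trans hxn.le hxn' (hu' x x.2 _ (t (n + 1)).2 h2.2 _ le_rfl hxn')
      · exact h3.2 _ hle (not_le.1 hxn')
  have all : ∀ n, JRel f fh c a (t n) := by
    intro n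
    induction n with
    | zero => rw [ht0]; simp [JRel]
    | succ n ih => exact ih.trans (t n).2.1 (hmono n.le_succ) (step n)
  have := all m
  rw [hm m le_rfl] at this
  exact this.2.2

theorem anti_left {g : ℝ → ℕ} {l x : ℝ} (hl : l < x)
    (hg : ∀ s t, l < s → s ≤ t → t < x → g t ≤ g s) : ∃ r, ∀ᶠ t in 𝓝[<] x, g t = r := by
  have hne : (g '' Ioo l x).Nonempty := (nonempty_Ioo.2 hl).image g
  obtain ⟨s, hs, hs'⟩ := Nat.sInf_mem hne
  refine ⟨sInf (g '' Ioo l x), ?_⟩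
  filter_upwards [Ioo_mem_nhdsLT hs.2] with t ht
  refine le_antisymm ?_ (Nat.sInf_le ⟨t, ⟨hs.1.trans ht.1, ht.2⟩, rfl⟩)
  rw [← hs']
  exact hg s t hs.1 ht.1.le ht.2

theorem mono_right {g : ℝ → ℕ} {u x : ℝ} (hu : x < u)
    (hg : ∀ s t, x < s → s ≤ t → t < u → g s ≤ g t) : ∃ r, ∀ᶠ t in 𝓝[>] x, g t = r := by
  have hne : (g '' Ioo x u).Nonempty := (nonempty_Ioo.2 hu).image g
  obtain ⟨s, hs, hs'⟩ := Nat.sInf_mem hne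
  refine ⟨sInf (g '' Ioo x u), ?_⟩
  filter_upwards [Ioo_mem_nhdsGT hs.1] with t ht
  refine le_antisymm ?_ (Nat.sInf_le ⟨t, ⟨ht.1, ht.2.trans hs.2⟩, rfl⟩)
  rw [← hs']
  exact hg t s ht.1 ht.2.le hs.2

end Jumps

section Chart
open Filter Topology Set
variable {k : Type*} [Fintype k] [DecidableEq k]

/-- Upper block. -/
def topB (Y : Matrix (k ⊕ k) k ℝ) : Matrix k k ℝ := Y.submatrix Sum.inl id

/-- Lower block. -/
def botB (Y : Matrix (k ⊕ k) k ℝ) : Matrix k k ℝ := Y.submatrix Sum.inr id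

theorem wron_eq (Y Yh : Matrix (k ⊕ k) k ℝ) :
    wron Y Yh = (topB Y)ᵀ * botB Yh - (botB Y)ᵀ * topB Yh := by
  have h : ∀ Y : Matrix (k ⊕ k) k ℝ, Y = fromRows (topB Y) (botB Y) := by
    intro Y; ext i j; cases i <;> rfl
  conv_lhs => rw [h Y, h Yh]
  rw [wron, Jmat, transpose_fromRows, fromCols_mul_fromBlocks, fromCols_mul_fromRows]
  simp
  abel

theorem mono_family_left {S : ℝ → Matrix k k ℝ} {l x : ℝ} (hl : l < x)
    (hS : ∀ t, l < t → t ≤ x → (S t).IsHermitian)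
    (hmono : ∀ s t, l < s → s ≤ t → t ≤ x → (S t - S s).PosSemidef)
    (hc : Tendsto S (𝓝[<] x) (𝓝 (S x))) :
    ∃ m, ∀ᶠ t in 𝓝[<] x, negInd (S t) = m ∧ (S t).rank = m + negInd (-(S x)) := by
  obtain ⟨m, hm⟩ := anti_left (g := fun t => negInd (S t)) hl
    (fun s t h1 h2 h3 => negInd_anti (hS s h1 (h2.trans h3.le)) (hmono s t h1 h2 h3.le))
  refine ⟨m, ?_⟩
  filter_upwards [hm, hc.neg.eventually (negInd_lsc (-(S x))), Ioo_mem_nhdsLT hl] with t h1 h2 h3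
  refine ⟨h1, ?_⟩
  have hh := hS t h3.1 h3.2.le
  rw [rank_eq_negInd hh, h1]
  congr 1
  refine le_antisymm ?_ (h2 hh.neg)
  apply negInd_anti (hS x hl le_rfl).neg
  have := hmono t x h3.1 h3.2.le le_rfl
  convert this using 1
  abel

theorem mono_family_right {S : ℝ → Matrix k k ℝ} {u x : ℝ} (hu : x < u)
    (hS : ∀ t, x ≤ t → t < u → (S t).IsHermitian)
    (hmono : ∀ s t, x ≤ s → s ≤ t → t < u → (S t - S s).PosSemidef)
    (hc : Tendsto S (𝓝[>] x) (𝓝 (S x))) :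
    ∃ r, ∀ᶠ t in 𝓝[>] x, negInd (S t) = negInd (S x) ∧ (S t).rank = r := by
  obtain ⟨m, hm⟩ := mono_right (g := fun t => negInd (-(S t))) hu
    (fun s t h1 h2 h3 => negInd_anti (hS t (h1.le.trans h2) h3).neg (by
      have := hmono s t h1.le h2 h3
      convert this using 1
      abel))
  refine ⟨negInd (S x) + m, ?_⟩
  filter_upwards [hm, hc.eventually (negInd_lsc (S x)), Ioo_mem_nhdsGT hu] with t h1 h2 h3
  have hh := hS t h3.1.le h3.2
  have h4 : negInd (S t) = negInd (S x) :=
    le_antisymm (negInd_anti (hS x le_rfl hu) (hmono x t le_rfl h3.1.le h3.2)) (h2 hh)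
  exact ⟨h4, by rw [rank_eq_negInd hh, h4, h1]⟩

theorem chart1 (Y2 Y : Matrix (k ⊕ k) k ℝ) (h22 : wron Y2 Y2 = 0) (h : wron Y Y = 0)
    (hX2 : IsUnit (topB Y2).det) (hW : IsUnit (wron Y2 Y).det) :
    ∃ Q V : Matrix k k ℝ, Q = botB Y2 * (topB Y2)⁻¹ ∧ Qᵀ = Q ∧ V = botB Y - Q * topB Y ∧
      IsUnit V.det ∧ (topB Y)ᵀ * V = Vᵀ * topB Y ∧ (topB Y2)ᵀ * V = wron Y2 Y ∧
      (topB Y2)⁻¹ * topB Y * (wron Y2 Y)⁻¹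
        = (topB Y2)⁻¹ * (topB Y * V⁻¹) * ((topB Y2)⁻¹)ᵀ ∧
      V * (wron Y2 Y)⁻¹ = ((topB Y2)⁻¹)ᵀ := by
  rw [wron_eq] at h22 h
  set X2 := topB Y2
  set U2 := botB Y2
  set X := topB Y
  set U := botB Y
  have hu1 := mul_nonsing_inv _ hX2
  have hu2 := nonsing_inv_mul _ hX2
  have hX2t : IsUnit X2ᵀ.det := by rwa [det_transpose]
  have h22' : X2ᵀ * U2 = U2ᵀ * X2 := sub_eq_zero.1 h22
  have h' : Xᵀ * U = Uᵀ * X := sub_eq_zero.1 h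
  have hQ' : X2ᵀ * (U2 * X2⁻¹) = U2ᵀ := by
    rw [← Matrix.mul_assoc, h22', Matrix.mul_assoc, hu1, Matrix.mul_one]
  have hQ : (U2 * X2⁻¹)ᵀ = U2 * X2⁻¹ := by
    have : (X2⁻¹)ᵀ * (X2ᵀ * (U2 * X2⁻¹)) = (X2⁻¹)ᵀ * U2ᵀ := by rw [hQ']
    rw [← Matrix.mul_assoc, ← transpose_mul, hu1, transpose_one, Matrix.one_mul] at this
    rw [transpose_mul, this]
  obtain ⟨Q, hQdef⟩ : ∃ Q, Q = U2 * X2⁻¹ := ⟨_, rfl⟩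
  rw [← hQdef] at hQ' hQ
  obtain ⟨V, hVdef⟩ : ∃ V, V = U - Q * X := ⟨_, rfl⟩
  have hWV : X2ᵀ * V = wron Y2 Y := by
    rw [wron_eq, hVdef, Matrix.mul_sub, ← Matrix.mul_assoc, hQ']
  have hV : IsUnit V.det := by
    rw [← hWV, det_mul] at hW
    exact isUnit_of_mul_isUnit_right hW
  have hWi : (wron Y2 Y)⁻¹ = V⁻¹ * (X2⁻¹)ᵀ := by
    rw [← hWV, Matrix.mul_inv_rev, transpose_nonsing_inv]
  refine ⟨Q, V, hQdef, hQ, hVdef, hV, ?_, hWV, ?_, ?_⟩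
  · rw [hVdef, Matrix.mul_sub, transpose_sub, Matrix.sub_mul, h', transpose_mul, hQ,
      Matrix.mul_assoc]
  · rw [hWi]; simp only [Matrix.mul_assoc]
  · rw [hWi, ← Matrix.mul_assoc, mul_nonsing_inv _ hV, Matrix.one_mul]

theorem chart_pt (Y2 Y Yh : Matrix (k ⊕ k) k ℝ) (h22 : wron Y2 Y2 = 0) (h : wron Y Y = 0)
    (hh : wron Yh Yh = 0) (hX2 : IsUnit (topB Y2).det) (hW : IsUnit (wron Y2 Y).det)
    (hWh : IsUnit (wron Y2 Yh).det) :
    ((topB Y2)⁻¹ * topB Y * (wron Y2 Y)⁻¹).IsHermitian ∧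
    ((topB Y2)⁻¹ * topB Yh * (wron Y2 Yh)⁻¹).IsHermitian ∧
    compIdx Y Yh + negInd ((topB Y2)⁻¹ * topB Y * (wron Y2 Y)⁻¹)
      = negInd ((topB Y2)⁻¹ * topB Yh * (wron Y2 Yh)⁻¹)
        + negInd (((wron Y2 Y)⁻¹)ᵀ * wron Y Yh * (wron Y2 Yh)⁻¹) := by
  obtain ⟨Q, V, hQd, hQ, hVd, hV, hXV, hWV, hS, -⟩ := chart1 Y2 Y h22 h hX2 hW
  obtain ⟨Q', Vh, hQd', -, hVhd, hVh, hXVh, hWVh, hSh, -⟩ := chart1 Y2 Yh h22 hh hX2 hWh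
  have : Q' = Q := by rw [hQd, hQd']
  subst this
  have hw : wron Y Yh = (topB Y)ᵀ * Vh - Vᵀ * topB Yh := by
    rw [wron_eq, hVd, hVhd, Matrix.mul_sub, transpose_sub, Matrix.sub_mul, transpose_mul, hQ,
      Matrix.mul_assoc]
    abel
  obtain ⟨s1, s2, s3⟩ := alg_main (topB Y) V (topB Yh) Vh hXV hXVh hV hVh (compM Y Yh)
    (1 - pinv (compM Y Yh) * compM Y Yh) (compD Y Yh) rfl rfl (by rw [← hw]; rfl)
  have hdet : IsUnit (((topB Y2)⁻¹)ᵀ).det := by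
    rw [det_transpose]; exact isUnit_nonsing_inv_det _ hX2
  have cg : ∀ A : Matrix k k ℝ, (topB Y2)⁻¹ * A * ((topB Y2)⁻¹)ᵀ
      = (((topB Y2)⁻¹)ᵀ)ᵀ * A * ((topB Y2)⁻¹)ᵀ := by
    intro A; rw [transpose_transpose]
  have hdiff : ((wron Y2 Y)⁻¹)ᵀ * wron Y Yh * (wron Y2 Yh)⁻¹
      = (topB Y2)⁻¹ * (topB Y * V⁻¹ - topB Yh * Vh⁻¹) * ((topB Y2)⁻¹)ᵀ := by
    have i1 : (V⁻¹)ᵀ * (topB Y)ᵀ = topB Y * V⁻¹ := by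
      rw [← transpose_mul, isHerm_iff.1 s1]
    have i2 : (V⁻¹)ᵀ * Vᵀ = 1 := by
      rw [← transpose_mul, mul_nonsing_inv _ hV, transpose_one]
    rw [← hWV, ← hWVh, hw, Matrix.mul_inv_rev, Matrix.mul_inv_rev, transpose_mul, transpose_nonsing_inv,
      transpose_nonsing_inv, transpose_transpose]
    rw [← transpose_nonsing_inv V, ]
    calc (topB Y2)⁻¹ * (V⁻¹)ᵀ * ((topB Y)ᵀ * Vh - Vᵀ * topB Yh) * (Vh⁻¹ * (topB Y2)ᵀ⁻¹)
        = (topB Y2)⁻¹ * ((V⁻¹)ᵀ * (topB Y)ᵀ * (Vh * Vh⁻¹) - ((V⁻¹)ᵀ * Vᵀ) * topB Yh * Vh⁻¹)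
            * (topB Y2)ᵀ⁻¹ := by
          simp only [Matrix.mul_sub, Matrix.sub_mul, Matrix.mul_assoc]
      _ = _ := by rw [i1, i2, mul_nonsing_inv _ hVh, Matrix.mul_one, Matrix.one_mul, transpose_nonsing_inv]
  rw [hS, hSh, hdiff, cg, cg, cg, negInd_congr s1 _ hdet, negInd_congr s2 _ hdet,
    negInd_congr (s1.sub s2) _ hdet]
  refine ⟨herm_congr s1 _, herm_congr s2 _, ?_⟩
  rw [compIdx, add_comm]
  exact s3

theorem pencil_finite (X U : Matrix k k ℝ) (h : Xᵀ * U = Uᵀ * X)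
    (hinj : ∀ c, X *ᵥ c = 0 → U *ᵥ c = 0 → c = 0) :
    {q : ℝ | (U - q • X).det = 0}.Finite := by
  have hex : ∀ q : {q : ℝ | (U - q • X).det = 0}, ∃ c, c ≠ 0 ∧ U *ᵥ c = (q : ℝ) • (X *ᵥ c) := by
    intro q
    obtain ⟨c, hc, hc'⟩ := exists_mulVec_eq_zero_iff.2 q.2
    refine ⟨c, hc, ?_⟩
    rw [sub_mulVec, smul_mulVec, sub_eq_zero] at hc'
    exact hc'
  choose c hc hUc using hex
  have hli : LinearIndependent ℝ
      (fun q : {q : ℝ | (U - q • X).det = 0} => (WithLp.toLp 2 (X *ᵥ c q) : EuclideanSpace ℝ k)) := by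
    apply linearIndependent_of_ne_zero_of_inner_eq_zero
    · intro q h0
      have h0 : X *ᵥ c q = 0 := by simpa using h0
      exact hc q (hinj _ h0 (by rw [hUc, h0, smul_zero]))
    · intro q r hqr
      have e1 : c q ⬝ᵥ (Xᵀ * U) *ᵥ c r = r * ((X *ᵥ c q) ⬝ᵥ (X *ᵥ c r)) := by
        rw [← mulVec_mulVec, hUc, mulVec_smul, dotProduct_smul, dotProduct_mulVec, vecMul_transpose]
        rfl
      have e2 : c q ⬝ᵥ (Xᵀ * U) *ᵥ c r = q * ((X *ᵥ c q) ⬝ᵥ (X *ᵥ c r)) := by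
        rw [h, ← mulVec_mulVec, dotProduct_mulVec, vecMul_transpose, hUc, smul_dotProduct]
        rfl
      have e3 : ((q : ℝ) - r) * ((X *ᵥ c q) ⬝ᵥ (X *ᵥ c r)) = 0 := by rw [sub_mul, ← e1, ← e2, sub_self]
      have hne : (q : ℝ) - r ≠ 0 := sub_ne_zero.2 fun h => hqr (Subtype.ext h)
      have e4 := (mul_eq_zero.1 e3).resolve_left hne
      rw [EuclideanSpace.inner_toLp_toLp, star_trivial, dotProduct_comm]
      exact e4
  have := hli.finite
  exact Set.toFinite _

theorem cont_inv {X2 : ℝ → Matrix k k ℝ} {s : Set ℝ} {x : ℝ} (hc : ContinuousWithinAt X2 s x)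
    (hd : IsUnit (X2 x).det) : ContinuousWithinAt (fun t => (X2 t)⁻¹) s x := by
  have h1 : ContinuousAt Inv.inv (X2 x) := by
    apply continuousAt_matrix_inv
    rw [Ring.inverse_eq_inv']
    exact continuousAt_inv₀ hd.ne_zero
  exact h1.comp_continuousWithinAt hc

theorem deriv_mul_zero {p r : ℝ → ℝ} {r' s : ℝ} (hp : ContinuousAt p s) (hr : HasDerivAt r r' s)
    (h0 : r s = 0) : HasDerivAt (fun t => p t * r t) (p s * r') s := by
  rw [hasDerivAt_iff_tendsto_slope] at hr ⊢
  have h1 : Tendsto p (𝓝[≠] s) (𝓝 (p s)) := hp.tendsto.mono_left nhdsWithin_le_nhds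
  refine (h1.mul hr).congr fun t => ?_
  simp only [slope, h0, vsub_eq_sub, smul_eq_mul]
  ring

theorem S_mono {l u : ℝ} (hlu : l ≤ u) (X2 X X2' X' : ℝ → Matrix k k ℝ) (Wi : Matrix k k ℝ)
    (hc2 : ContinuousOn X2 (Icc l u)) (hc : ContinuousOn X (Icc l u))
    (hd2 : ∀ t ∈ Ioo l u, ∀ i j, HasDerivAt (fun t => X2 t i j) (X2' t i j) t)
    (hd : ∀ t ∈ Ioo l u, ∀ i j, HasDerivAt (fun t => X t i j) (X' t i j) t)
    (hdet : ∀ t ∈ Icc l u, IsUnit (X2 t).det)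
    (hherm : ∀ t ∈ Icc l u, ((X2 t)⁻¹ * X t * Wi).IsHermitian)
    (hpos : ∀ t ∈ Ioo l u, ∀ v : k → ℝ,
      0 ≤ v ⬝ᵥ ((X2 t)⁻¹ * (X' t * Wi - X2' t * ((X2 t)⁻¹ * X t * Wi))) *ᵥ v) :
    ((X2 u)⁻¹ * X u * Wi - (X2 l)⁻¹ * X l * Wi).PosSemidef := by
  have hci : ContinuousOn (fun t => (X2 t)⁻¹) (Icc l u) := fun t ht => cont_inv (hc2 t ht) (hdet t ht)
  have hcS : ContinuousOn (fun t => (X2 t)⁻¹ * X t * Wi) (Icc l u) :=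
    (ContinuousOn.mul hci hc).mul continuousOn_const
  refine PosSemidef.of_dotProduct_mulVec_nonneg
    ((hherm u (right_mem_Icc.2 hlu)).sub (hherm l (left_mem_Icc.2 hlu))) fun v => ?_
  rw [star_trivial, sub_mulVec, dotProduct_sub, sub_nonneg]
  have key : ∀ s ∈ Ioo l u, HasDerivAt (fun t => v ⬝ᵥ ((X2 t)⁻¹ * X t * Wi) *ᵥ v)
      (v ⬝ᵥ ((X2 s)⁻¹ * (X' s * Wi - X2' s * ((X2 s)⁻¹ * X s * Wi))) *ᵥ v) s := by
    intro s hs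
    set Ss := (X2 s)⁻¹ * X s * Wi with hSs
    have hnb : Icc l u ∈ 𝓝 s := Icc_mem_nhds hs.1 hs.2
    have hr : ∀ j, HasDerivAt (fun t => ((X t * Wi - X2 t * Ss) *ᵥ v) j)
        (((X' s * Wi - X2' s * Ss) *ᵥ v) j) s := by
      intro j
      simp only [mulVec, dotProduct, Matrix.sub_apply, Matrix.mul_apply]
      refine HasDerivAt.fun_sum fun i _ => ?_
      refine HasDerivAt.mul_const ?_ _
      refine HasDerivAt.sub (HasDerivAt.fun_sum fun m _ => ?_) (HasDerivAt.fun_sum fun m _ => ?_)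
      · exact (hd s hs j m).mul_const _
      · exact (hd2 s hs j m).mul_const _
    have hr0 : ∀ j, ((X s * Wi - X2 s * Ss) *ᵥ v) j = 0 := by
      intro j
      have : X s * Wi - X2 s * Ss = 0 := by
        rw [hSs, Matrix.mul_assoc, mul_nonsing_inv_cancel_left _ _ (hdet s ⟨hs.1.le, hs.2.le⟩), sub_self]
      rw [this, zero_mulVec]; rfl
    have hp : ∀ j, ContinuousAt (fun t => (v ᵥ* (X2 t)⁻¹) j) s := by
      intro j
      have h1 : ContinuousAt (fun t => (X2 t)⁻¹) s := hci.continuousAt hnb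
      simp only [vecMul, dotProduct]
      refine tendsto_finsetSum _ fun i _ => ?_
      have h2 := (continuous_apply_apply (ρ := fun (_ _ : k) => ℝ) i j).continuousAt.comp h1
      exact (continuousAt_const.mul h2)
    have hsum : HasDerivAt (fun t => v ⬝ᵥ Ss *ᵥ v + ∑ j, (v ᵥ* (X2 t)⁻¹) j * ((X t * Wi - X2 t * Ss) *ᵥ v) j)
        (∑ j, (v ᵥ* (X2 s)⁻¹) j * ((X' s * Wi - X2' s * Ss) *ᵥ v) j) s :=
      (HasDerivAt.fun_sum fun j _ => deriv_mul_zero (hp j) (hr j) (hr0 j)).const_add _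
    have hval : (v ⬝ᵥ ((X2 s)⁻¹ * (X' s * Wi - X2' s * Ss)) *ᵥ v)
        = ∑ j, (v ᵥ* (X2 s)⁻¹) j * ((X' s * Wi - X2' s * Ss) *ᵥ v) j := by
      rw [← mulVec_mulVec, dotProduct_mulVec]; rfl
    rw [hval]
    refine hsum.congr_of_eventuallyEq ?_
    filter_upwards [hnb] with t ht
    have e1 : ∑ j, (v ᵥ* (X2 t)⁻¹) j * ((X t * Wi - X2 t * Ss) *ᵥ v) j
        = v ⬝ᵥ ((X2 t)⁻¹ * (X t * Wi - X2 t * Ss)) *ᵥ v := by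
      rw [← mulVec_mulVec, dotProduct_mulVec]; rfl
    rw [e1, Matrix.mul_sub, nonsing_inv_mul_cancel_left _ _ (hdet t ht), sub_mulVec, dotProduct_sub,
      Matrix.mul_assoc]
    ring
  have hm : MonotoneOn (fun t => v ⬝ᵥ ((X2 t)⁻¹ * X t * Wi) *ᵥ v) (Icc l u) := by
    refine monotoneOn_of_deriv_nonneg (convex_Icc l u) ?_ ?_ ?_
    · have : Continuous (fun A : Matrix k k ℝ => v ⬝ᵥ A *ᵥ v) :=
        continuous_const.dotProduct (continuous_id.matrix_mulVec continuous_const)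
      exact this.comp_continuousOn hcS
    · rw [interior_Icc]
      exact fun s hs => (key s hs).differentiableAt.differentiableWithinAt
    · rw [interior_Icc]
      intro s hs
      rw [(key s hs).deriv]
      exact hpos s hs v
  exact hm (left_mem_Icc.2 hlu) (right_mem_Icc.2 hlu) hlu

theorem JTJ : (Jmat k)ᵀ * Jmat k = 1 := by
  simp [Jmat, fromBlocks_transpose, fromBlocks_multiply]

theorem JJT : Jmat k * (Jmat k)ᵀ = 1 := by
  simp [Jmat, fromBlocks_transpose, fromBlocks_multiply]

theorem symp_det {S : Matrix (k ⊕ k) (k ⊕ k) ℝ} (h : IsSymplectic S) : IsUnit S.det := by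
  apply isUnit_det_of_left_inverse (B := (Jmat k)ᵀ * (Sᵀ * Jmat k))
  rw [Matrix.mul_assoc, h, JTJ]

theorem wron_symp {S : Matrix (k ⊕ k) (k ⊕ k) ℝ} (h : IsSymplectic S) (G1 G2 : Matrix (k ⊕ k) k ℝ) :
    wron (S * G1) (S * G2) = wron G1 G2 := by
  have h' : Sᵀ * Jmat k * S = Jmat k := h
  calc wron (S * G1) (S * G2) = G1ᵀ * (Sᵀ * Jmat k * S) * G2 := by
        simp only [wron, transpose_mul, Matrix.mul_assoc]
    _ = _ := by rw [h']; rfl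

theorem deriv_top (Zh Zh' : ℝ → Matrix (k ⊕ k) (k ⊕ k) ℝ) (t : ℝ) (h : IsSymplectic (Zh t))
    (G : Matrix (k ⊕ k) k ℝ) :
    topB (Zh' t * G) = (Psi Zh Zh' t).toBlocks₂₁ * topB (Zh t * G)
      + (Psi Zh Zh' t).toBlocks₂₂ * botB (Zh t * G) := by
  have e : Zh' t = Jmat k * (Psi Zh Zh' t) * Zh t := by
    rw [Psi, Matrix.mul_assoc (Jmat k), Matrix.mul_assoc _ _ (Zh t), nonsing_inv_mul _ (symp_det h),
      Matrix.mul_one, ← Matrix.mul_assoc, JJT, Matrix.one_mul]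
  have hs : Zh t * G = fromRows (topB (Zh t * G)) (botB (Zh t * G)) := by
    ext i j; cases i <;> rfl
  have e2 : Zh' t * G = Jmat k * (Psi Zh Zh' t * (Zh t * G)) := by
    conv_lhs => rw [e]
    simp only [Matrix.mul_assoc]
  rw [e2]
  generalize Psi Zh Zh' t = P
  conv_lhs => rw [hs, ← fromBlocks_toBlocks P, Jmat, fromBlocks_mul_fromRows, fromBlocks_mul_fromRows]
  ext i j
  simp [topB]

theorem chart_mono {a b l u : ℝ} (hlu : l ≤ u) (hsub : Icc l u ⊆ Icc a b)
    (Zh Zh' : ℝ → Matrix (k ⊕ k) (k ⊕ k) ℝ)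
    (hZh : ∀ l ∈ Set.Icc a b, IsSymplectic (Zh l))
    (hdZh : ∀ l ∈ Set.Icc a b, ∀ i j,
      HasDerivWithinAt (fun t => Zh t i j) (Zh' l i j) (Set.Icc a b) l)
    (hleg : ∀ l ∈ Set.Icc a b, ((Psi Zh Zh' l).toBlocks₂₂).PosSemidef)
    (G2 G : Matrix (k ⊕ k) k ℝ) (h22 : wron G2 G2 = 0) (h : wron G G = 0)
    (hW : IsUnit (wron G2 G).det) (hdet : ∀ t ∈ Icc l u, IsUnit (topB (Zh t * G2)).det) :
    ((topB (Zh u * G2))⁻¹ * topB (Zh u * G) * (wron G2 G)⁻¹ -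
      (topB (Zh l * G2))⁻¹ * topB (Zh l * G) * (wron G2 G)⁻¹).PosSemidef := by
  have hdd : ∀ G : Matrix (k ⊕ k) k ℝ, ∀ t ∈ Icc a b, ∀ i j,
      HasDerivWithinAt (fun t => topB (Zh t * G) i j) (topB (Zh' t * G) i j) (Icc a b) t := by
    intro G t ht i j
    simp only [topB, submatrix_apply, Matrix.mul_apply]
    exact HasDerivWithinAt.fun_sum fun m _ => (hdZh t ht _ _).mul_const _
  have hcc : ∀ G : Matrix (k ⊕ k) k ℝ, ContinuousOn (fun t => topB (Zh t * G)) (Icc l u) := by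
    intro G
    refine continuousOn_pi.2 fun i => continuousOn_pi.2 fun j => fun t ht => ?_
    exact (hdd G t (hsub ht) i j).continuousWithinAt.mono hsub
  have hda : ∀ G : Matrix (k ⊕ k) k ℝ, ∀ t ∈ Ioo l u, ∀ i j,
      HasDerivAt (fun t => topB (Zh t * G) i j) (topB (Zh' t * G) i j) t := by
    intro G t ht i j
    exact (hdd G t (hsub (Ioo_subset_Icc_self ht)) i j).hasDerivAt
      (mem_of_superset (Icc_mem_nhds ht.1 ht.2) hsub)
  have hch : ∀ t ∈ Icc l u, ∃ Q V : Matrix k k ℝ, Q = botB (Zh t * G2) * (topB (Zh t * G2))⁻¹ ∧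
      V = botB (Zh t * G) - Q * topB (Zh t * G) ∧ IsUnit V.det ∧
      (topB (Zh t * G))ᵀ * V = Vᵀ * topB (Zh t * G) ∧
      (topB (Zh t * G2))⁻¹ * topB (Zh t * G) * (wron G2 G)⁻¹
        = (topB (Zh t * G2))⁻¹ * (topB (Zh t * G) * V⁻¹) * ((topB (Zh t * G2))⁻¹)ᵀ ∧
      V * (wron G2 G)⁻¹ = ((topB (Zh t * G2))⁻¹)ᵀ := by
    intro t ht
    have hs := hZh t (hsub ht)
    obtain ⟨Q, V, h1, _, h3, h4, h5, _, h7, h8⟩ := chart1 (Zh t * G2) (Zh t * G)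
      (by rw [wron_symp hs, h22]) (by rw [wron_symp hs, h]) (hdet t ht) (by rwa [wron_symp hs])
    rw [wron_symp hs] at h7 h8
    exact ⟨Q, V, h1, h3, h4, h5, h7, h8⟩
  refine S_mono hlu (fun t => topB (Zh t * G2)) (fun t => topB (Zh t * G))
    (fun t => topB (Zh' t * G2)) (fun t => topB (Zh' t * G)) _ (hcc G2) (hcc G) (hda G2) (hda G) hdet ?_ ?_
  · intro t ht
    have hs := hZh t (hsub ht)
    have := (chart_pt (Zh t * G2) (Zh t * G) (Zh t * G)
      (by rw [wron_symp hs, h22]) (by rw [wron_symp hs, h]) (by rw [wron_symp hs, h]) (hdet t ht)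
      (by rwa [wron_symp hs]) (by rwa [wron_symp hs])).1
    rwa [wron_symp hs] at this
  · intro t ht v
    have ht' := Ioo_subset_Icc_self ht
    obtain ⟨Q, V, h1, h3, h4, h5, h7, h8⟩ := hch t ht'
    have hs := hZh t (hsub ht')
    have hX := hdet t ht'
    simp only [deriv_top Zh Zh' t hs]
    have hP := hleg t (hsub ht')
    revert hP
    generalize (Psi Zh Zh' t).toBlocks₂₂ = P
    generalize (Psi Zh Zh' t).toBlocks₂₁ = R
    intro hP
    generalize topB (Zh t * G2) = X2 at *
    generalize topB (Zh t * G) = X at *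
    generalize botB (Zh t * G2) = U2 at *
    generalize botB (Zh t * G) = U at *
    generalize (wron G2 G)⁻¹ = Wi at *
    have e : (R * X + P * U) * Wi - (R * X2 + P * U2) * (X2⁻¹ * X * Wi) = P * (X2⁻¹)ᵀ := by
      rw [← h8, h3, h1]
      have : X2 * (X2⁻¹ * X * Wi) = X * Wi := by
        rw [Matrix.mul_assoc, mul_nonsing_inv_cancel_left _ _ hX]
      rw [Matrix.add_mul (R * X2), Matrix.mul_assoc R X2, this]
      simp only [Matrix.add_mul, Matrix.mul_assoc, Matrix.sub_mul, Matrix.mul_sub]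
      abel
    rw [e]
    have hP2 := hP.mul_mul_conjTranspose_same X2⁻¹
    have := hP2.dotProduct_mulVec_nonneg v
    rw [conjTranspose_eq_transpose_of_trivial, star_trivial, Matrix.mul_assoc] at this
    exact this

theorem chart_exists {S : Matrix (k ⊕ k) (k ⊕ k) ℝ} (hS : IsSymplectic S)
    (G Gh : Matrix (k ⊕ k) k ℝ) (h : wron G G = 0) (hh : wron Gh Gh = 0)
    (hi : ∀ c, G *ᵥ c = 0 → c = 0) (hih : ∀ c, Gh *ᵥ c = 0 → c = 0) :
    ∃ G2 : Matrix (k ⊕ k) k ℝ, wron G2 G2 = 0 ∧ IsUnit (wron G2 G).det ∧ IsUnit (wron G2 Gh).det ∧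
      topB (S * G2) = 1 := by
  have hd := symp_det hS
  have pf : ∀ G : Matrix (k ⊕ k) k ℝ, wron G G = 0 → (∀ c, G *ᵥ c = 0 → c = 0) →
      {q : ℝ | (botB (S * G) - q • topB (S * G)).det = 0}.Finite := by
    intro G h hi
    apply pencil_finite
    · have := wron_symp hS G G
      rw [h, wron_eq, sub_eq_zero] at this
      exact this
    · intro c h1 h2
      apply hi
      have h3 : (S * G) *ᵥ c = 0 := by
        ext i
        cases i with
        | inl i => exact congrFun h1 i
        | inr i => exact congrFun h2 i
      rw [← mulVec_mulVec] at h3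
      have := congrArg (S⁻¹ *ᵥ ·) h3
      simpa [mulVec_mulVec, nonsing_inv_mul _ hd, ← Matrix.mul_assoc] using this
  obtain ⟨q, hq⟩ := ((pf G h hi).union (pf Gh hh hih)).exists_notMem
  rw [mem_union, not_or] at hq
  have e : S * (S⁻¹ * fromRows (1 : Matrix k k ℝ) (q • (1 : Matrix k k ℝ)))
      = fromRows (1 : Matrix k k ℝ) (q • (1 : Matrix k k ℝ)) := by
    rw [mul_nonsing_inv_cancel_left _ _ hd]
  have t1 : topB (fromRows (1 : Matrix k k ℝ) (q • (1 : Matrix k k ℝ))) = 1 := by ext i j; rfl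
  have t2 : botB (fromRows (1 : Matrix k k ℝ) (q • (1 : Matrix k k ℝ))) = q • 1 := by ext i j; rfl
  have w : ∀ G : Matrix (k ⊕ k) k ℝ, wron (S⁻¹ * fromRows (1 : Matrix k k ℝ) (q • (1 : Matrix k k ℝ))) G
      = botB (S * G) - q • topB (S * G) := by
    intro G
    rw [← wron_symp hS, e, wron_eq, t1, t2]
    simp
  refine ⟨S⁻¹ * fromRows (1 : Matrix k k ℝ) (q • (1 : Matrix k k ℝ)), ?_, ?_, ?_, ?_⟩
  · rw [w, e, t1, t2, sub_self]
  · rw [w]; exact isUnit_iff_ne_zero.2 hq.1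
  · rw [w]; exact isUnit_iff_ne_zero.2 hq.2
  · rw [e, t1]

theorem local_chart {a b : ℝ}
    (Zh Zh' : ℝ → Matrix (k ⊕ k) (k ⊕ k) ℝ)
    (hZh : ∀ l ∈ Set.Icc a b, IsSymplectic (Zh l))
    (hdZh : ∀ l ∈ Set.Icc a b, ∀ i j,
      HasDerivWithinAt (fun t => Zh t i j) (Zh' l i j) (Set.Icc a b) l)
    (hleg : ∀ l ∈ Set.Icc a b, ((Psi Zh Zh' l).toBlocks₂₂).PosSemidef)
    (G Gh : Matrix (k ⊕ k) k ℝ) (h : wron G G = 0) (hh : wron Gh Gh = 0)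
    (hi : ∀ c, G *ᵥ c = 0 → c = 0) (hih : ∀ c, Gh *ᵥ c = 0 → c = 0)
    (x : ℝ) (hx : x ∈ Icc a b) :
    ∃ (S Sh : ℝ → Matrix k k ℝ) (κ : ℕ) (ε : ℝ), 0 < ε ∧
      (∀ t ∈ Icc a b, |t - x| < ε → (S t).IsHermitian ∧ (Sh t).IsHermitian ∧
        compIdx (Zh t * G) (Zh t * Gh) + negInd (S t) = negInd (Sh t) + κ ∧
        (S t).rank = (topB (Zh t * G)).rank ∧ (Sh t).rank = (topB (Zh t * Gh)).rank) ∧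
      (∀ s ∈ Icc a b, ∀ t ∈ Icc a b, |s - x| < ε → |t - x| < ε → s ≤ t →
        (S t - S s).PosSemidef ∧ (Sh t - Sh s).PosSemidef) ∧
      ContinuousWithinAt S (Icc a b) x ∧ ContinuousWithinAt Sh (Icc a b) x := by
  obtain ⟨G2, h22, hW, hWh, hone⟩ := chart_exists (hZh x hx) G Gh h hh hi hih
  have hcc : ∀ G : Matrix (k ⊕ k) k ℝ, ContinuousOn (fun t => topB (Zh t * G)) (Icc a b) := by
    intro G
    refine continuousOn_pi.2 fun i => continuousOn_pi.2 fun j => fun t ht => ?_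
    simp only [topB, submatrix_apply, Matrix.mul_apply]
    exact (HasDerivWithinAt.fun_sum fun m _ => (hdZh t ht _ _).mul_const _).continuousWithinAt
  have hdx : IsUnit (topB (Zh x * G2)).det := by rw [hone, det_one]; exact isUnit_one
  have hev : ∀ᶠ t in 𝓝[Icc a b] x, (topB (Zh t * G2)).det ≠ 0 := by
    have : ContinuousWithinAt (fun t => (topB (Zh t * G2)).det) (Icc a b) x :=
      (continuous_id.matrix_det).continuousAt.comp_continuousWithinAt (hcc G2 x hx)
    exact this.eventually_ne hdx.ne_zero
  obtain ⟨ε, hε, hball⟩ := Metric.mem_nhdsWithin_iff.1 hev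
  have hdet : ∀ t ∈ Icc a b, |t - x| < ε → IsUnit (topB (Zh t * G2)).det := by
    intro t ht hlt
    exact isUnit_iff_ne_zero.2 (hball ⟨by rwa [Metric.mem_ball, Real.dist_eq], ht⟩)
  have hrank : ∀ A B C : Matrix k k ℝ, IsUnit A.det → IsUnit C.det → (A⁻¹ * B * C⁻¹).rank = B.rank := by
    intro A B C hA hC
    rw [rank_mul_eq_left_of_isUnit_det _ _ (isUnit_nonsing_inv_det _ hC),
      rank_mul_eq_right_of_isUnit_det _ _ (isUnit_nonsing_inv_det _ hA)]
  have hcS : ∀ G W : _, ContinuousWithinAt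
      (fun t => (topB (Zh t * G2))⁻¹ * topB (Zh t * G) * (W : Matrix k k ℝ)) (Icc a b) x := fun G W =>
    ((cont_inv (hcc G2 x hx) hdx).mul (hcc G x hx)).mul continuousWithinAt_const
  refine ⟨fun t => (topB (Zh t * G2))⁻¹ * topB (Zh t * G) * (wron G2 G)⁻¹,
    fun t => (topB (Zh t * G2))⁻¹ * topB (Zh t * Gh) * (wron G2 Gh)⁻¹,
    negInd (((wron G2 G)⁻¹)ᵀ * wron G Gh * (wron G2 Gh)⁻¹), ε, hε, ?_, ?_, hcS G _, hcS Gh _⟩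
  · intro t ht hlt
    have hs := hZh t ht
    have hD := hdet t ht hlt
    have := chart_pt (Zh t * G2) (Zh t * G) (Zh t * Gh)
      (by rw [wron_symp hs, h22]) (by rw [wron_symp hs, h]) (by rw [wron_symp hs, hh]) hD
      (by rwa [wron_symp hs]) (by rwa [wron_symp hs])
    simp only [wron_symp hs] at this
    exact ⟨this.1, this.2.1, this.2.2, hrank _ _ _ hD hW, hrank _ _ _ hD hWh⟩
  · intro s hs t ht hse hte hst
    have hsub : Icc s t ⊆ Icc a b := Icc_subset_Icc hs.1 ht.2
    have hd : ∀ r ∈ Icc s t, IsUnit (topB (Zh r * G2)).det := by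
      intro r hr
      apply hdet r (hsub hr)
      rw [abs_lt] at *
      constructor <;> linarith [hr.1, hr.2, hse.1, hte.2]
    exact ⟨chart_mono hst hsub Zh Zh' hZh hdZh hleg G2 G h22 h hW hd,
      chart_mono hst hsub Zh Zh' hZh hdZh hleg G2 Gh h22 hh hWh hd⟩

theorem main_thm {a b : ℝ} (hab : a ≤ b)
    (Zh Zh' : ℝ → Matrix (k ⊕ k) (k ⊕ k) ℝ)
    (hZh : ∀ l ∈ Set.Icc a b, IsSymplectic (Zh l))
    (hdZh : ∀ l ∈ Set.Icc a b, ∀ i j,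
      HasDerivWithinAt (fun t => Zh t i j) (Zh' l i j) (Set.Icc a b) l)
    (hleg : ∀ l ∈ Set.Icc a b, ((Psi Zh Zh' l).toBlocks₂₂).PosSemidef)
    (G Gh : Matrix (k ⊕ k) k ℝ) (h : wron G G = 0) (hh : wron Gh Gh = 0)
    (hi : ∀ c, G *ᵥ c = 0 → c = 0) (hih : ∀ c, Gh *ᵥ c = 0 → c = 0)
    (Y Yh : ℝ → Matrix (k ⊕ k) k ℝ) (hY : ∀ t ∈ Icc a b, Y t = Zh t * G)
    (hYh : ∀ t ∈ Icc a b, Yh t = Zh t * Gh) :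
    (∑ᶠ x ∈ Ioc a b, jmp (fun t => (topB (Yh t)).rank) x)
      - (∑ᶠ x ∈ Ioc a b, jmp (fun t => (topB (Y t)).rank) x)
      = (compIdx (Y a) (Yh a) : ℤ) - (compIdx (Y b) (Yh b) : ℤ) := by
  refine jump_main hab (fun t => (topB (Y t)).rank) (fun t => (topB (Yh t)).rank)
    (fun t => (compIdx (Y t) (Yh t) : ℤ)) ?_ ?_
  · intro x hx
    have hx' : x ∈ Icc a b := Ioc_subset_Icc_self hx
    obtain ⟨S, Sh, κ, ε, hε, hp, hm, hc, hch⟩ :=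
      local_chart Zh Zh' hZh hdZh hleg G Gh h hh hi hih x hx'
    have hl : max a (x - ε) < x := max_lt hx.1 (by linarith)
    have hin : ∀ t, max a (x - ε) < t → t ≤ x → t ∈ Icc a b ∧ |t - x| < ε := by
      intro t h1 h2
      rw [max_lt_iff] at h1
      exact ⟨⟨h1.1.le, h2.trans hx.2⟩, by rw [abs_lt]; constructor <;> linarith [h1.2]⟩
    have hle : 𝓝[<] x ≤ 𝓝[Icc a b] x := by
      refine nhdsWithin_le_of_mem ?_
      filter_upwards [Ioo_mem_nhdsLT hl] with t ht using (hin t ht.1 ht.2.le).1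
    obtain ⟨m, hm1⟩ := mono_family_left (S := S) hl
      (fun t h1 h2 => (hp t (hin t h1 h2).1 (hin t h1 h2).2).1)
      (fun s t h1 h2 h3 => (hm s (hin s h1 (h2.trans h3)).1 t (hin t (h1.trans_le h2) h3).1
        (hin s h1 (h2.trans h3)).2 (hin t (h1.trans_le h2) h3).2 h2).1) (hc.mono_left hle)
    obtain ⟨mh, hm2⟩ := mono_family_left (S := Sh) hl
      (fun t h1 h2 => (hp t (hin t h1 h2).1 (hin t h1 h2).2).2.1)
      (fun s t h1 h2 h3 => (hm s (hin s h1 (h2.trans h3)).1 t (hin t (h1.trans_le h2) h3).1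
        (hin s h1 (h2.trans h3)).2 (hin t (h1.trans_le h2) h3).2 h2).2) (hch.mono_left hle)
    refine ⟨m + negInd (-(S x)), mh + negInd (-(Sh x)), (mh : ℤ) + κ - m, ?_, ?_⟩
    · filter_upwards [hm1, hm2, Ioo_mem_nhdsLT hl] with t h1 h2 ht
      obtain ⟨ht1, ht2⟩ := hin t ht.1 ht.2.le
      obtain ⟨_, _, p3, p4, p5⟩ := hp t ht1 ht2
      rw [hY t ht1, hYh t ht1, ← p4, ← p5]
      refine ⟨h1.2, h2.2, ?_⟩
      rw [h1.1, h2.1] at p3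
      omega
    · obtain ⟨p1, p2, p3, p4, p5⟩ := hp x hx' (by simpa using hε)
      simp only [hY x hx', hYh x hx', ← p4, ← p5]
      have r1 := rank_eq_negInd p1
      have r2 := rank_eq_negInd p2
      omega
  · intro x hx
    have hx' : x ∈ Icc a b := Ico_subset_Icc_self hx
    obtain ⟨S, Sh, κ, ε, hε, hp, hm, hc, hch⟩ :=
      local_chart Zh Zh' hZh hdZh hleg G Gh h hh hi hih x hx'
    have hl : x < min b (x + ε) := lt_min hx.2 (by linarith)
    have hin : ∀ t, x ≤ t → t < min b (x + ε) → t ∈ Icc a b ∧ |t - x| < ε := by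
      intro t h2 h1
      rw [lt_min_iff] at h1
      exact ⟨⟨hx.1.trans h2, h1.1.le⟩, by rw [abs_lt]; constructor <;> linarith [h1.2]⟩
    have hle : 𝓝[>] x ≤ 𝓝[Icc a b] x := by
      refine nhdsWithin_le_of_mem ?_
      filter_upwards [Ioo_mem_nhdsGT hl] with t ht using (hin t ht.1.le ht.2).1
    obtain ⟨m, hm1⟩ := mono_family_right (S := S) hl
      (fun t h1 h2 => (hp t (hin t h1 h2).1 (hin t h1 h2).2).1)
      (fun s t h1 h2 h3 => (hm s (hin s h1 (h2.trans_lt h3)).1 t (hin t (h1.trans h2) h3).1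
        (hin s h1 (h2.trans_lt h3)).2 (hin t (h1.trans h2) h3).2 h2).1) (hc.mono_left hle)
    obtain ⟨mh, hm2⟩ := mono_family_right (S := Sh) hl
      (fun t h1 h2 => (hp t (hin t h1 h2).1 (hin t h1 h2).2).2.1)
      (fun s t h1 h2 h3 => (hm s (hin s h1 (h2.trans_lt h3)).1 t (hin t (h1.trans h2) h3).1
        (hin s h1 (h2.trans_lt h3)).2 (hin t (h1.trans h2) h3).2 h2).2) (hch.mono_left hle)
    refine ⟨m, mh, ?_⟩
    filter_upwards [hm1, hm2, Ioo_mem_nhdsGT hl] with t h1 h2 ht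
    obtain ⟨ht1, ht2⟩ := hin t ht.1.le ht.2
    obtain ⟨_, _, p3, p4, p5⟩ := hp t ht1 ht2
    obtain ⟨_, _, q3, q4, q5⟩ := hp x hx' (by simpa using hε)
    simp only [hY t ht1, hYh t ht1, hY x hx', hYh x hx', ← p4, ← p5]
    refine ⟨h1.2, h2.2, ?_⟩
    rw [h1.1, h2.1] at p3
    omega

end Chart

/-- Separation theorem for the continuous case: if `Ẑ(λ)⁻¹Z(λ)` is constant,
the majorant condition `Ẑᵀ(Ψ(Z)−Ψ(Ẑ))Ẑ ≥ 0` holds, and the lower-right block of `Ψ(Ẑ)` is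
`≥ 0`, then for `Y = Z(0;I)`, `Ŷ = Ẑ(0;I)` the numbers of proper focal points satisfy
`l_c(Ŷ,a,b) − l_c(Y,a,b) = μ(Y(a),Ŷ(a)) − μ(Y(b),Ŷ(b))`. -/
theorem statement19 (n : ℕ) (a b : ℝ) (hab : a ≤ b)
    (Z Z' Zh Zh' : ℝ → Matrix (Fin n ⊕ Fin n) (Fin n ⊕ Fin n) ℝ)
    (hZ : ∀ l ∈ Set.Icc a b, IsSymplectic (Z l))
    (hZh : ∀ l ∈ Set.Icc a b, IsSymplectic (Zh l))
    (hdZ : ∀ l ∈ Set.Icc a b, ∀ i j,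
      HasDerivWithinAt (fun t => Z t i j) (Z' l i j) (Set.Icc a b) l)
    (hdZh : ∀ l ∈ Set.Icc a b, ∀ i j,
      HasDerivWithinAt (fun t => Zh t i j) (Zh' l i j) (Set.Icc a b) l)
    (hconst : ∀ l ∈ Set.Icc a b, ∀ m ∈ Set.Icc a b, (Zh l)⁻¹ * Z l = (Zh m)⁻¹ * Z m)
    (hmaj : ∀ l ∈ Set.Icc a b,
      ((Zh l)ᵀ * (Psi Z Z' l - Psi Zh Zh' l) * Zh l).PosSemidef)
    (hleg : ∀ l ∈ Set.Icc a b, ((Psi Zh Zh' l).toBlocks₂₂).PosSemidef) :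
    (∑ᶠ x ∈ Set.Ioc a b,
        jmp (fun t => ((Zh t * fromRows (0 : Matrix (Fin n) (Fin n) ℝ) 1).submatrix
          Sum.inl id).rank) x)
      - (∑ᶠ x ∈ Set.Ioc a b,
        jmp (fun t => ((Z t * fromRows (0 : Matrix (Fin n) (Fin n) ℝ) 1).submatrix
          Sum.inl id).rank) x)
      = (compIdx (Z a * fromRows (0 : Matrix (Fin n) (Fin n) ℝ) 1)
            (Zh a * fromRows (0 : Matrix (Fin n) (Fin n) ℝ) 1) : ℤ)
        - (compIdx (Z b * fromRows (0 : Matrix (Fin n) (Fin n) ℝ) 1)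
            (Zh b * fromRows (0 : Matrix (Fin n) (Fin n) ℝ) 1) : ℤ) := by
  have ha : a ∈ Set.Icc a b := Set.left_mem_Icc.2 hab
  have hZe : ∀ t ∈ Set.Icc a b, Z t = Zh t * ((Zh a)⁻¹ * Z a) := by
    intro t ht
    rw [← hconst t ht a ha, mul_nonsing_inv_cancel_left _ _ (symp_det (hZh t ht))]
  have hE0 : wron (fromRows (0 : Matrix (Fin n) (Fin n) ℝ) (1 : Matrix (Fin n) (Fin n) ℝ)) (fromRows (0 : Matrix (Fin n) (Fin n) ℝ) (1 : Matrix (Fin n) (Fin n) ℝ)) = 0 := by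
    have ht : topB (fromRows (0 : Matrix (Fin n) (Fin n) ℝ) (1 : Matrix (Fin n) (Fin n) ℝ)) = 0 := by ext i j; rfl
    rw [wron_eq, ht]
    simp
  have hEi : ∀ c, fromRows (0 : Matrix (Fin n) (Fin n) ℝ) (1 : Matrix (Fin n) (Fin n) ℝ) *ᵥ c = 0 → c = 0 := by
    intro c hc
    rw [fromRows_mulVec] at hc
    ext i
    have := congrFun hc (Sum.inr i)
    simpa using this
  refine main_thm hab Zh Zh' hZh hdZh hleg ((Zh a)⁻¹ * Z a * fromRows (0 : Matrix (Fin n) (Fin n) ℝ) (1 : Matrix (Fin n) (Fin n) ℝ)) (fromRows (0 : Matrix (Fin n) (Fin n) ℝ) (1 : Matrix (Fin n) (Fin n) ℝ)) ?_ hE0 ?_ hEi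
    (fun t => Z t * fromRows (0 : Matrix (Fin n) (Fin n) ℝ) (1 : Matrix (Fin n) (Fin n) ℝ)) (fun t => Zh t * fromRows (0 : Matrix (Fin n) (Fin n) ℝ) (1 : Matrix (Fin n) (Fin n) ℝ)) ?_ (fun t _ => rfl)
  · rw [← wron_symp (hZh a ha), ← Matrix.mul_assoc, ← hZe a ha, wron_symp (hZ a ha), hE0]
  · intro c hc
    apply hEi
    have h2 := congrArg (((Z a)⁻¹ * Zh a) *ᵥ ·) hc
    have e : (Z a)⁻¹ * Zh a * ((Zh a)⁻¹ * Z a * fromRows (0 : Matrix (Fin n) (Fin n) ℝ) (1 : Matrix (Fin n) (Fin n) ℝ))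
        = fromRows (0 : Matrix (Fin n) (Fin n) ℝ) (1 : Matrix (Fin n) (Fin n) ℝ) := by
      rw [Matrix.mul_assoc, ← Matrix.mul_assoc (Zh a), ← hZe a ha,
        nonsing_inv_mul_cancel_left _ _ (symp_det (hZ a ha))]
    simp only [mulVec_mulVec, mulVec_zero] at h2
    rwa [e] at h2
  · intro t ht
    show Z t * fromRows (0 : Matrix (Fin n) (Fin n) ℝ) (1 : Matrix (Fin n) (Fin n) ℝ) = Zh t * ((Zh a)⁻¹ * Z a * fromRows (0 : Matrix (Fin n) (Fin n) ℝ) (1 : Matrix (Fin n) (Fin n) ℝ))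
    rw [← Matrix.mul_assoc, ← hZe t ht]
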